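/- arXiv:1311.2219 — 10 statements merged into one kernel-verified Lean document; each statement's English description precedes it below -/
import Mathlib

section
/- Let S be an order on the finite set X and let (x,y) be a pair adjacent for S. Then R = S − {(x,y)} is an order on X, and R is maximal in S. -/
open scoped BigOperators ContinuousMap

variable {X : Type*}

/-- A relation `R ⊆ X × X` is an order: reflexive, transitive, antisymmetric. -/
def IsOrder (R : Set (X × X)) : Prop :=
  (∀ x : X, (x, x) ∈ R) ∧
  (∀ x y z : X, (x, y) ∈ R → (y, z) ∈ R → (x, z) ∈ R) ∧
  (∀ x y : X, (x, y) ∈ R → (y, x) ∈ R → x = y)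

/-- The opposite relation. -/
def opRel (R : Set (X × X)) : Set (X × X) := {p | (p.2, p.1) ∈ R}

/-- The equality relation `Δ` on `X`. -/
def delta (X : Type*) : Set (X × X) := {p | p.1 = p.2}

/-- `(x, y)` is an adjacent pair for `S` : `x <_S y` and `]x, y[_S = ∅`. -/
def Adjacent (S : Set (X × X)) (x y : X) : Prop :=
  (x, y) ∈ S ∧ x ≠ y ∧ ∀ z : X, (x, z) ∈ S → x ≠ z → (z, y) ∈ S → z ≠ y → False

/-- The order `R` is maximal in the order `S`. -/
def IsMaximalIn (R S : Set (X × X)) : Prop :=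
  IsOrder R ∧ R ⊂ S ∧ ∀ T : Set (X × X), IsOrder T → R ⊂ T → ¬ T ⊂ S

/-- The order `R^(2)` on `X × X` : `(x,y) ≤ (x',y')` iff `x ≤_R x'` and `y' ≤_R y`. -/
def le2 (R : Set (X × X)) (p q : X × X) : Prop := (p.1, q.1) ∈ R ∧ (q.2, p.2) ∈ R

/-- `p` is a minimal element of `(X × X) − (R ∪ R^op)` for the relation `R^(2)`. -/
def MinimalPair (R : Set (X × X)) (p : X × X) : Prop :=
  p ∉ R ∪ opRel R ∧ ∀ q : X × X, q ∉ R ∪ opRel R → le2 R q p → q = p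

/-- The Frattini subrelation of `S` : the intersection (inside `S`) of all
maximal order subrelations of `S`. -/
def frattiniRel (S : Set (X × X)) : Set (X × X) :=
  {p ∈ S | ∀ R : Set (X × X), IsMaximalIn R S → p ∈ R}

/-- Composition of relations. -/
def composeRel (R S : Set (X × X)) : Set (X × X) := {p | ∃ z : X, (p.1, z) ∈ R ∧ (z, p.2) ∈ S}

/-- The transitive closure of a relation: the smallest transitive relation containing it. -/
def transClosure (U : Set (X × X)) : Set (X × X) :=
  {p | Relation.TransGen (fun a b => (a, b) ∈ U) p.1 p.2}

/-- `]·, x[_R`. -/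
def lowerSet (R : Set (X × X)) (x : X) : Set X := {z | (z, x) ∈ R ∧ z ≠ x}

/-- `]x, ·[_R`. -/
def upperSet (R : Set (X × X)) (x : X) : Set X := {z | (x, z) ∈ R ∧ x ≠ z}

/-- The set `𝓔_R`. -/
def eSet (R : Set (X × X)) : Set (X × X) :=
  {p | p ∉ R ∪ opRel R ∧ lowerSet R p.1 ⊆ lowerSet R p.2 ∧ upperSet R p.2 ⊆ upperSet R p.1}

/-- The geometric realization of the order complex (nerve) of a poset `P`:
convex combinations of elements of `P` whose support is a chain. -/
def orderComplex (P : Type*) [PartialOrder P] : Set (P → ℝ) :=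
  {f | (∀ p, 0 ≤ f p) ∧ (∑ᶠ p, f p) = 1 ∧ IsChain (· ≤ ·) {p | f p ≠ 0}}

/-- Lemma 3.4(1): removing an adjacent pair from an order `S` yields an order
which is maximal in `S`. -/
theorem removeAdjacent_isOrder_and_maximal {X : Type*} [Fintype X]
    (S : Set (X × X)) (hS : IsOrder S) (x y : X) (hxy : Adjacent S x y) :
    IsOrder (S \ {(x, y)}) ∧ IsMaximalIn (S \ {(x, y)}) S := by
  obtain ⟨hrefl, htrans, hanti⟩ := hS
  obtain ⟨hmem, hne, hadj⟩ := hxy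
  have hR : IsOrder (S \ {(x, y)}) := by
    refine ⟨fun a => ⟨hrefl a, ?_⟩, ?_, fun a b hab hba => hanti a b hab.1 hba.1⟩
    · intro h
      obtain ⟨rfl, rfl⟩ := Prod.mk.inj h
      exact hne rfl
    · rintro a b c ⟨hab, hab'⟩ ⟨hbc, hbc'⟩
      refine ⟨htrans a b c hab hbc, fun h => ?_⟩
      obtain ⟨rfl, rfl⟩ := Prod.mk.inj h
      refine hadj b hab ?_ hbc ?_
      · rintro rfl
        exact hbc' rfl
      · rintro rfl
        exact hab' rfl
  have hcov : S \ {(x, y)} ⋖ S := Set.sdiff_singleton_covBy hmem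
  exact ⟨hR, hR, hcov.lt, fun T _ hRT hTS => hcov.2 hRT hTS⟩
end

section
/- Let R ⊂ S be orders on the finite set X such that R is maximal in S. Then the set S − R consists of a single pair (x,y); this pair is adjacent for S, and it is a minimal element of (X × X) − (R ∪ R^op) for the relation R^(2). -/
open scoped BigOperators ContinuousMap

variable {X : Type*}

/-- A nonempty set of pairs on a finite type has a minimal element for `R^(2)`. -/
theorem IsOrder.exists_minimal_le2 {X : Type*} [Finite X] {R A : Set (X × X)}
    (hR : IsOrder R) (hA : A.Nonempty) :
    ∃ p ∈ A, ∀ q ∈ A, le2 R q p → q = p := by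
  obtain ⟨-, htrans, hanti⟩ := hR
  let r : X × X → X × X → Prop := fun q p => le2 R q p ∧ q ≠ p
  have : IsTrans (X × X) r := ⟨by
    rintro a b c ⟨⟨h1, h2⟩, h⟩ ⟨⟨h3, h4⟩, -⟩
    refine ⟨⟨htrans _ _ _ h1 h3, htrans _ _ _ h4 h2⟩, ?_⟩
    rintro rfl
    exact h (Prod.ext (hanti _ _ h1 h3) (hanti _ _ h4 h2))⟩
  have : Std.Irrefl r := ⟨fun _ h => h.2 rfl⟩
  obtain ⟨p, hp, hmin⟩ := (Finite.wellFounded_of_trans_of_irrefl r).has_min A hA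
  exact ⟨p, hp, fun q hq hqp => by_contra fun hne => hmin q hq ⟨hqp, hne⟩⟩

/-- Adding to `R` an `R^(2)`-minimal pair of `S - R` gives an order. -/
theorem IsOrder.insert_of_minimal {X : Type*} {R S : Set (X × X)} {p : X × X}
    (hR : IsOrder R) (hS : IsOrder S) (hRS : R ⊆ S) (hp : p ∈ S)
    (hmin : ∀ q ∈ S \ R, le2 R q p → q = p) : IsOrder (insert p R) := by
  obtain ⟨x, y⟩ := p
  have hsub : insert (x, y) R ⊆ S := Set.insert_subset hp hRS
  have hlower : ∀ z, (z, x) ∈ R → (z, y) ∈ insert (x, y) R := fun z hz => by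
    by_contra hzy
    exact hzy (Or.inl (hmin (z, y)
      ⟨hS.2.1 _ _ _ (hRS hz) hp, fun h => hzy (Or.inr h)⟩ ⟨hz, hR.1 y⟩))
  have hupper : ∀ z, (y, z) ∈ R → (x, z) ∈ insert (x, y) R := fun z hz => by
    by_contra hxz
    exact hxz (Or.inl (hmin (x, z)
      ⟨hS.2.1 _ _ _ hp (hRS hz), fun h => hxz (Or.inr h)⟩ ⟨hR.1 x, hz⟩))
  refine ⟨fun a => Or.inr (hR.1 a), ?_, fun a b hab hba => hS.2.2 a b (hsub hab) (hsub hba)⟩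
  rintro a b c (hab | hab) (hbc | hbc)
  · obtain ⟨rfl, rfl⟩ := Prod.mk.inj hab
    obtain ⟨rfl, rfl⟩ := Prod.mk.inj hbc
    exact Or.inl rfl
  · obtain ⟨rfl, rfl⟩ := Prod.mk.inj hab
    exact hupper c hbc
  · obtain ⟨rfl, rfl⟩ := Prod.mk.inj hbc
    exact hlower a hab
  · exact Or.inr (hR.2.1 _ _ _ hab hbc)

/-- Lemma 3.4(2): if `R` is maximal in `S`, then `S − R` is a single pair `(x, y)`,
which is adjacent for `S` and a minimal element of `(X × X) − (R ∪ R^op)` for `R^(2)`. -/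
theorem maximal_diff_singleton {X : Type*} [Fintype X]
    (R S : Set (X × X)) (hR : IsOrder R) (hS : IsOrder S) (hmax : IsMaximalIn R S) :
    ∃ x y : X, S \ R = {(x, y)} ∧ Adjacent S x y ∧ MinimalPair R (x, y) := by
  obtain ⟨-, hRS, hT⟩ := hmax
  obtain ⟨⟨x, y⟩, ⟨hxyS, hxyR⟩, hmin⟩ :=
    hR.exists_minimal_le2 (Set.nonempty_of_ssubset hRS)
  have hins : insert (x, y) R = S := by
    by_contra hne
    exact hT _ (hR.insert_of_minimal hS hRS.subset hxyS hmin) (Set.ssubset_insert hxyR)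
      ((Set.insert_subset hxyS hRS.subset).ssubset_of_ne hne)
  have hmem : ∀ q ∈ S, q ≠ (x, y) → q ∈ R := fun q hq hne =>
    (hins.symm.subset hq).resolve_left hne
  have hne : x ≠ y := by
    rintro rfl
    exact hxyR (hR.1 x)
  refine ⟨x, y, ?_, ⟨hxyS, hne, ?_⟩, ?_, ?_⟩
  · ext q
    refine ⟨fun hq => by_contra fun h => hq.2 (hmem q hq.1 h), ?_⟩
    rintro rfl
    exact ⟨hxyS, hxyR⟩
  · intro z hxz hxz' hzy hzy'
    exact hxyR (hR.2.1 x z y (hmem _ hxz fun h => hzy' (Prod.mk.inj h).2)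
      (hmem _ hzy fun h => hxz' (Prod.mk.inj h).1.symm))
  · rintro (h | h)
    · exact hxyR h
    · exact hne (hS.2.2 x y hxyS (hRS.subset h))
  · rintro ⟨a, b⟩ hq hle
    have hab : (a, b) ∈ S :=
      hS.2.1 _ _ _ (hRS.subset hle.1) (hS.2.1 _ _ _ hxyS (hRS.subset hle.2))
    exact hmin _ ⟨hab, fun h => hq (Or.inl h)⟩ hle
end

section
/- Let R be an order on the finite set X, and let (x,y) be a minimal element of (X × X) − (R ∪ R^op) for the relation R^(2). Then S = R ∪ {(x,y)} is an order on X, and R is maximal in S. -/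
open scoped BigOperators ContinuousMap

variable {X : Type*}

/-- Lemma 3.4(3): adding to an order `R` a minimal element of `(X × X) − (R ∪ R^op)`
for `R^(2)` yields an order in which `R` is maximal. -/
theorem addMinimal_isOrder_and_maximal {X : Type*} [Fintype X]
    (R : Set (X × X)) (hR : IsOrder R) (x y : X) (hmin : MinimalPair R (x, y)) :
    IsOrder (R ∪ {(x, y)}) ∧ IsMaximalIn R (R ∪ {(x, y)}) := by
  obtain ⟨hrefl, htrans, hanti⟩ := hR
  obtain ⟨hxy, hmin⟩ := hmin
  have hnxy : (x, y) ∉ R := fun h => hxy (Or.inl h)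
  have hnyx : (y, x) ∉ R := fun h => hxy (Or.inr h)
  have below : ∀ a, (a, x) ∈ R → (a, y) ∈ R ∪ {(x, y)} := by
    intro a ha
    by_cases h : (a, y) ∈ R ∪ opRel R
    · rcases h with h | h
      · exact Or.inl h
      · exact absurd (htrans y a x h ha) hnyx
    · exact Or.inr (hmin (a, y) h ⟨ha, hrefl y⟩)
  have above : ∀ b, (y, b) ∈ R → (x, b) ∈ R ∪ {(x, y)} := by
    intro b hb
    by_cases h : (x, b) ∈ R ∪ opRel R
    · rcases h with h | h
      · exact Or.inl h
      · exact absurd (htrans y b x hb h) hnyx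
    · exact Or.inr (hmin (x, b) h ⟨hrefl x, hb⟩)
  refine ⟨⟨fun a => Or.inl (hrefl a), ?_, ?_⟩, ⟨hrefl, htrans, hanti⟩, ?_, ?_⟩
  · rintro a b c (hab | hab) (hbc | hbc)
    · exact Or.inl (htrans a b c hab hbc)
    · obtain ⟨rfl, rfl⟩ := Prod.mk.inj hbc
      exact below a hab
    · obtain ⟨rfl, rfl⟩ := Prod.mk.inj hab
      exact above c hbc
    · obtain ⟨rfl, rfl⟩ := Prod.mk.inj hab
      exact Or.inr (Prod.ext rfl (Prod.mk.inj hbc).2)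
  · rintro a b (hab | hab) (hba | hba)
    · exact hanti a b hab hba
    · obtain ⟨rfl, rfl⟩ := Prod.mk.inj hba
      exact absurd hab hnyx
    · obtain ⟨rfl, rfl⟩ := Prod.mk.inj hab
      exact absurd hba hnyx
    · exact (Prod.mk.inj hab).1.trans (Prod.mk.inj hba).1.symm
  · exact Set.ssubset_iff_subset_ne.2
      ⟨Set.subset_union_left, fun h => hnxy (h ▸ Or.inr rfl)⟩
  · rintro T - hRT hTS
    obtain ⟨p, hpT, hpR⟩ := Set.exists_of_ssubset hRT
    obtain rfl : p = (x, y) := (hTS.1 hpT).resolve_left hpR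
    exact hTS.2 (Set.union_subset hRT.1 (Set.singleton_subset_iff.2 hpT))
end

section
/- Let S be an order on the finite set X. Then Φ(S) = Δ ∪ (S−Δ)∘(S−Δ); in other words, a pair (x,y) belongs to Φ(S) if and only if either x = y, or x <_S y and there exists z with x <_S z <_S y. -/
open scoped BigOperators ContinuousMap

variable {X : Type*}

theorem IsOrder.diff_singleton_of_adjacent {X : Type*} {S : Set (X × X)} (hS : IsOrder S)
    {x y : X} (h : Adjacent S x y) : IsOrder (S \ {(x, y)}) := by
  obtain ⟨hr, ht, ha⟩ := hS
  obtain ⟨-, hne, hc⟩ := h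
  refine ⟨fun a => ⟨hr a, ?_⟩, ?_, fun a b hab hba => ha a b hab.1 hba.1⟩
  · rintro heq
    obtain ⟨rfl, rfl⟩ := Prod.mk.inj heq
    exact hne rfl
  · rintro a b c ⟨hab, hab'⟩ ⟨hbc, hbc'⟩
    refine ⟨ht a b c hab hbc, fun heq => ?_⟩
    obtain ⟨rfl, rfl⟩ := Prod.mk.inj heq
    refine hc b hab ?_ hbc ?_
    · rintro rfl
      exact hbc' rfl
    · rintro rfl
      exact hab' rfl

theorem diff_singleton_ssubset_of_adjacent {X : Type*} {S : Set (X × X)} {x y : X}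
    (h : Adjacent S x y) : S \ {(x, y)} ⊂ S :=
  ⟨Set.sdiff_subset, fun hsub => (hsub h.1).2 rfl⟩

theorem IsOrder.isMaximalIn_diff_singleton {X : Type*} {S : Set (X × X)} (hS : IsOrder S)
    {x y : X} (h : Adjacent S x y) : IsMaximalIn (S \ {(x, y)}) S := by
  refine ⟨hS.diff_singleton_of_adjacent h, diff_singleton_ssubset_of_adjacent h, ?_⟩
  rintro T - ⟨hRT, hTR⟩ ⟨hTS, hST⟩
  by_cases hm : (x, y) ∈ T
  · refine hST fun p hp => ?_
    by_cases hpe : p = (x, y)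
    · exact hpe ▸ hm
    · exact hRT ⟨hp, hpe⟩
  · exact hTR fun p hp => ⟨hTS hp, fun hpe => hm (hpe ▸ hp)⟩

/-- An order on a finite set is generated by its adjacent pairs. -/
theorem IsOrder.subset_of_forall_adjacent_mem {X : Type*} [Finite X] {R S : Set (X × X)}
    (hS : IsOrder S) (hR : IsOrder R) (h : ∀ x y, Adjacent S x y → (x, y) ∈ R) : S ⊆ R := by
  obtain ⟨hr, ht, ha⟩ := hS
  suffices H : ∀ (n : ℕ) (x y : X), {z | (x, z) ∈ S ∧ (z, y) ∈ S}.ncard = n →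
      (x, y) ∈ S → (x, y) ∈ R from fun p hp => H _ p.1 p.2 rfl hp
  intro n
  induction n using Nat.strong_induction_on with
  | _ n ih =>
    intro x y hn hxy
    by_cases hne : x = y
    · exact hne ▸ hR.1 x
    by_cases hadj : Adjacent S x y
    · exact h x y hadj
    obtain ⟨z, hxz, hxz', hzy, hzy'⟩ :
        ∃ z, (x, z) ∈ S ∧ x ≠ z ∧ (z, y) ∈ S ∧ z ≠ y := by
      by_contra! hcon
      exact hadj ⟨hxy, hne, fun z h₁ h₂ h₃ h₄ => h₄ (hcon z h₁ h₂ h₃)⟩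
    refine hR.2.1 x z y (ih _ ?_ x z rfl hxz) (ih _ ?_ z y rfl hzy)
    · rw [← hn]
      refine Set.ncard_lt_ncard ⟨fun w hw => ⟨hw.1, ht w z y hw.2 hzy⟩, fun hsub => ?_⟩
      exact hzy' (ha z y hzy (hsub (a := y) ⟨hxy, hr y⟩).2)
    · rw [← hn]
      refine Set.ncard_lt_ncard ⟨fun w hw => ⟨ht x z w hxz hw.1, hw.2⟩, fun hsub => ?_⟩
      exact hxz' (ha x z hxz (hsub (a := x) ⟨hr x, hxy⟩).1)

theorem IsMaximalIn.exists_eq_diff_singleton {X : Type*} [Finite X] {R S : Set (X × X)}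
    (hS : IsOrder S) (hR : IsMaximalIn R S) :
    ∃ x y, Adjacent S x y ∧ R = S \ {(x, y)} := by
  obtain ⟨hRo, hRS, hmax⟩ := hR
  obtain ⟨x, y, hadj, hxy⟩ : ∃ x y, Adjacent S x y ∧ (x, y) ∉ R := by
    by_contra! hcon
    exact hRS.2 (hS.subset_of_forall_adjacent_mem hRo hcon)
  refine ⟨x, y, hadj, ?_⟩
  have hsub : R ⊆ S \ {(x, y)} := fun p hp => ⟨hRS.1 hp, fun hpe => hxy (hpe ▸ hp)⟩
  by_contra hne
  exact hmax _ (hS.diff_singleton_of_adjacent hadj) (hsub.ssubset_of_ne hne)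
    (diff_singleton_ssubset_of_adjacent hadj)

theorem mem_frattiniRel_iff_not_adjacent {X : Type*} [Finite X] {S : Set (X × X)}
    (hS : IsOrder S) (x y : X) :
    (x, y) ∈ frattiniRel S ↔ (x, y) ∈ S ∧ ¬ Adjacent S x y := by
  refine ⟨fun h => ⟨h.1, fun hadj => (h.2 _ (hS.isMaximalIn_diff_singleton hadj)).2 rfl⟩, ?_⟩
  rintro ⟨hxy, hnot⟩
  refine ⟨hxy, fun R hR => ?_⟩
  obtain ⟨a, b, hab, rfl⟩ := hR.exists_eq_diff_singleton hS
  refine ⟨hxy, fun heq => ?_⟩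
  obtain ⟨rfl, rfl⟩ := Prod.mk.inj heq
  exact hnot hab

/-- Proposition 3.6: `Φ(S) = Δ ∪ (S − Δ) ∘ (S − Δ)`; in other words `(x, y) ∈ Φ(S)`
iff `x = y`, or `x <_S y` and `]x, y[_S ≠ ∅`. -/
theorem frattiniRel_eq {X : Type*} [Fintype X] (S : Set (X × X)) (hS : IsOrder S) :
    frattiniRel S = delta X ∪ composeRel (S \ delta X) (S \ delta X) ∧
    ∀ x y : X, (x, y) ∈ frattiniRel S ↔
      x = y ∨ ((x, y) ∈ S ∧ x ≠ y ∧ ∃ z : X, (x, z) ∈ S ∧ x ≠ z ∧ (z, y) ∈ S ∧ z ≠ y) := by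
  have key : ∀ x y : X, (x, y) ∈ frattiniRel S ↔
      x = y ∨ ((x, y) ∈ S ∧ x ≠ y ∧ ∃ z : X, (x, z) ∈ S ∧ x ≠ z ∧ (z, y) ∈ S ∧ z ≠ y) := by
    intro x y
    rw [mem_frattiniRel_iff_not_adjacent hS]
    constructor
    · rintro ⟨hxy, hnot⟩
      by_contra! hcon
      exact hnot ⟨hxy, hcon.1, fun z h₁ h₂ h₃ h₄ => h₄ (hcon.2 hxy hcon.1 z h₁ h₂ h₃)⟩
    · rintro (rfl | ⟨hxy, -, z, h₁, h₂, h₃, h₄⟩)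
      · exact ⟨hS.1 x, fun h => h.2.1 rfl⟩
      · exact ⟨hxy, fun h => h.2.2 z h₁ h₂ h₃ h₄⟩
  refine ⟨?_, key⟩
  ext ⟨x, y⟩
  rw [key]
  refine or_congr Iff.rfl ⟨?_, ?_⟩
  · rintro ⟨-, -, z, h₁, h₂, h₃, h₄⟩
    exact ⟨z, ⟨h₁, h₂⟩, ⟨h₃, h₄⟩⟩
  · rintro ⟨z, ⟨h₁, h₂⟩, ⟨h₃, h₄⟩⟩
    refine ⟨hS.2.1 x z y h₁ h₃, ?_, z, h₁, h₂, h₃, h₄⟩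
    rintro rfl
    exact h₂ (hS.2.2 x z h₁ h₃)
end

section
/- Let R ⊆ S be orders on the finite set X, and suppose there exist x, y, z ∈ X with x <_S y <_S z and (x,z) ∉ R. Then the open interval ]R,S[ = {T ∈ Ω_X : R ⊂ T ⊂ S} is a contractible poset: the geometric realization of its order complex (the nerve of the poset) is a contractible topological space. -/
open scoped BigOperators ContinuousMap

variable {X : Type*}

section OrderComplex

variable {P : Type*}

open Classical in
/-- The push-forward along `f` of the weight function `w`. -/
noncomputable def pushWeight [Fintype P] (f : P → P) (w : P → ℝ) (r : P) : ℝ :=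
  ∑ p, if f p = r then w p else 0

theorem sum_pushWeight [Fintype P] (f : P → P) (w : P → ℝ) :
    ∑ r, pushWeight f w r = ∑ p, w p := by
  classical
  unfold pushWeight
  rw [Finset.sum_comm]
  simp

theorem pushWeight_nonneg [Fintype P] (f : P → P) {w : P → ℝ} (hw : ∀ p, 0 ≤ w p) (r : P) :
    0 ≤ pushWeight f w r :=
  Finset.sum_nonneg fun p _ => by split_ifs <;> simp [hw]

theorem exists_of_pushWeight_ne_zero [Fintype P] {f : P → P} {w : P → ℝ} {r : P}
    (h : pushWeight f w r ≠ 0) : ∃ p, f p = r ∧ w p ≠ 0 := by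
  obtain ⟨p, -, hp⟩ := Finset.exists_ne_zero_of_sum_ne_zero h
  exact ⟨p, by simpa using hp⟩

theorem continuous_pushWeight [Fintype P] (f : P → P) (r : P) :
    Continuous fun w : P → ℝ => pushWeight f w r :=
  continuous_finsetSum _ fun p _ => by split_ifs <;> fun_prop

variable [PartialOrder P]

open Classical in
/-- The total weight of the elements strictly above `p`. -/
noncomputable def weightAbove [Fintype P] (w : P → ℝ) (p : P) : ℝ :=
  ∑ q, if p < q then w q else 0

/-- The part of the weight `w p` lying in the top `t` of the total mass, when the mass of a chain
is laid out in decreasing order. -/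
noncomputable def topWeight [Fintype P] (t : ℝ) (w : P → ℝ) (p : P) : ℝ :=
  max 0 (min (w p) (t - weightAbove w p))

theorem weightAbove_nonneg [Fintype P] {w : P → ℝ} (hw : ∀ p, 0 ≤ w p) (p : P) :
    0 ≤ weightAbove w p :=
  Finset.sum_nonneg fun q _ => by split_ifs <;> simp [hw]

theorem weightAbove_add_le_weightAbove [Fintype P] {w : P → ℝ} (hw : ∀ p, 0 ≤ w p) {p q : P}
    (h : q < p) : weightAbove w p + w p ≤ weightAbove w q := by
  classical
  have hp : w p = ∑ r, if p = r then w r else 0 := by simp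
  rw [hp, weightAbove, weightAbove, ← Finset.sum_add_distrib]
  refine Finset.sum_le_sum fun r _ => ?_
  by_cases h₁ : p < r
  · simp [h₁, h₁.ne, h.trans h₁]
  · by_cases h₂ : p = r
    · subst h₂
      simp [h]
    · simp only [h₁, h₂, if_false, add_zero]
      split_ifs <;> simp [hw]

theorem weightAbove_add_le_sum [Fintype P] {w : P → ℝ} (hw : ∀ p, 0 ≤ w p) (p : P) :
    weightAbove w p + w p ≤ ∑ q, w q := by
  classical
  have hp : w p = ∑ r, if p = r then w r else 0 := by simp
  rw [hp, weightAbove, ← Finset.sum_add_distrib]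
  refine Finset.sum_le_sum fun r _ => ?_
  by_cases h₁ : p < r
  · simp [h₁, h₁.ne]
  · by_cases h₂ : p = r <;> simp [h₁, h₂, hw]

theorem topWeight_nonneg [Fintype P] (t : ℝ) (w : P → ℝ) (p : P) : 0 ≤ topWeight t w p :=
  le_max_left _ _

theorem topWeight_le [Fintype P] (t : ℝ) {w : P → ℝ} (hw : ∀ p, 0 ≤ w p) (p : P) :
    topWeight t w p ≤ w p :=
  max_le (hw p) (min_le_left _ _)

theorem topWeight_zero [Fintype P] {w : P → ℝ} (hw : ∀ p, 0 ≤ w p) (p : P) :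
    topWeight 0 w p = 0 :=
  max_eq_left ((min_le_right _ _).trans (by linarith [weightAbove_nonneg hw p]))

theorem topWeight_one [Fintype P] {w : P → ℝ} (hw : ∀ p, 0 ≤ w p) (h1 : ∑ p, w p = 1) (p : P) :
    topWeight 1 w p = w p := by
  have := weightAbove_add_le_sum hw p
  rw [topWeight, min_eq_left (by linarith), max_eq_right (hw p)]

theorem weightAbove_lt_of_topWeight_ne_zero [Fintype P] {t : ℝ} {w : P → ℝ} {p : P}
    (h : topWeight t w p ≠ 0) : weightAbove w p < t := by
  by_contra! h'
  exact h (max_eq_left ((min_le_right _ _).trans (by linarith)))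

theorem lt_weightAbove_add_of_topWeight_ne [Fintype P] {t : ℝ} {w : P → ℝ} (hw : ∀ p, 0 ≤ w p)
    {p : P} (h : topWeight t w p ≠ w p) : t < weightAbove w p + w p := by
  by_contra! h'
  refine h ?_
  rw [topWeight, min_eq_left (by linarith), max_eq_right (hw p)]

theorem mem_orderComplex [Fintype P] {w : P → ℝ} :
    w ∈ orderComplex P ↔
      (∀ p, 0 ≤ w p) ∧ ∑ p, w p = 1 ∧ IsChain (· ≤ ·) {p | w p ≠ 0} := by
  rw [orderComplex, Set.mem_ofPred_eq, finsum_eq_sum_of_fintype]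

theorem topWeight_push_mem_orderComplex [Fintype P] {f : P → P} (hf : Monotone f)
    (hle : ∀ p, p ≤ f p) (t : ℝ) {w : P → ℝ} (hw : w ∈ orderComplex P) :
    (fun r => w r - topWeight t w r + pushWeight f (topWeight t w) r) ∈ orderComplex P := by
  rw [mem_orderComplex] at hw ⊢
  obtain ⟨h0, h1, hc⟩ := hw
  refine ⟨fun r => add_nonneg (sub_nonneg.2 (topWeight_le t h0 r))
    (pushWeight_nonneg f (topWeight_nonneg t w) r), ?_, ?_⟩
  · rw [Finset.sum_add_distrib, Finset.sum_sub_distrib, sum_pushWeight, h1]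
    ring
  have supp : ∀ p, topWeight t w p ≠ 0 → w p ≠ 0 := fun p hp hp' =>
    hp (le_antisymm ((topWeight_le t h0 p).trans hp'.le) (topWeight_nonneg t w p))
  have split : ∀ r, w r - topWeight t w r + pushWeight f (topWeight t w) r ≠ 0 →
      (w r ≠ 0 ∧ topWeight t w r ≠ w r) ∨ ∃ q, f q = r ∧ topWeight t w q ≠ 0 := by
    intro r hr
    by_cases h : topWeight t w r = w r
    · exact .inr (exists_of_pushWeight_ne_zero (by simpa [h] using hr))
    · refine .inl ⟨fun h' => h ?_, h⟩
      by_contra h''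
      exact supp r (fun h3 => h (h3.trans h'.symm)) h'
  have cross : ∀ p q, w p ≠ 0 → topWeight t w p ≠ w p → topWeight t w q ≠ 0 → p ≤ f q := by
    intro p q hp hp' hq
    have hlt : ¬ q < p := fun h => by
      linarith [weightAbove_add_le_weightAbove h0 h, weightAbove_lt_of_topWeight_ne_zero hq,
        lt_weightAbove_add_of_topWeight_ne h0 hp']
    rcases hc.total hp (supp q hq) with h | h
    · exact h.trans (hle q)
    · exact (h.eq_of_not_lt hlt ▸ hle q)
  intro a ha b hb _
  rcases split a ha with ⟨ha, ha'⟩ | ⟨p, rfl, hp⟩ <;>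
    rcases split b hb with ⟨hb, hb'⟩ | ⟨q, rfl, hq⟩
  · exact hc.total ha hb
  · exact .inl (cross a q ha ha' hq)
  · exact .inr (cross b p hb hb' hp)
  · exact (hc.total (supp p hp) (supp q hq)).imp (fun h => hf h) (fun h => hf h)

open Classical in
theorem lineMap_push_mem_orderComplex [Fintype P] {f : P → P} (hf : Monotone f) {c : P}
    (hc : ∀ p, c ≤ f p) {t : ℝ} (ht0 : 0 ≤ t) (ht1 : t ≤ 1) {w : P → ℝ}
    (hw : w ∈ orderComplex P) :
    (fun r => (1 - t) * pushWeight f w r + t * (if c = r then 1 else 0)) ∈ orderComplex P := by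
  rw [mem_orderComplex] at hw ⊢
  obtain ⟨h0, h1, hch⟩ := hw
  refine ⟨fun r => add_nonneg (mul_nonneg (sub_nonneg.2 ht1) (pushWeight_nonneg f h0 r))
    (mul_nonneg ht0 (by split_ifs <;> simp)), ?_, ?_⟩
  · rw [Finset.sum_add_distrib, ← Finset.mul_sum, ← Finset.mul_sum, sum_pushWeight, h1]
    simp
  have split : ∀ r, (1 - t) * pushWeight f w r + t * (if c = r then 1 else 0) ≠ 0 →
      c = r ∨ ∃ q, f q = r ∧ w q ≠ 0 := by
    intro r hr
    by_cases h : c = r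
    · exact .inl h
    · refine .inr (exists_of_pushWeight_ne_zero fun h' => hr ?_)
      simp [h, h']
  intro a ha b hb hab
  rcases split a ha with rfl | ⟨p, rfl, hp⟩ <;> rcases split b hb with rfl | ⟨q, rfl, hq⟩
  · exact absurd rfl hab
  · exact .inl (hc q)
  · exact .inr (hc p)
  · exact (hch.total hp hq).imp (fun h => hf h) (fun h => hf h)

theorem continuous_weightAbove [Fintype P] (p : P) :
    Continuous fun w : P → ℝ => weightAbove w p :=
  continuous_finsetSum _ fun q _ => by split_ifs <;> fun_prop

theorem continuous_topWeight [Fintype P] (p : P) :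
    Continuous fun x : ℝ × (P → ℝ) => topWeight x.1 x.2 p := by
  have := continuous_weightAbove p
  unfold topWeight
  fun_prop

/-- A finite poset with a monotone map `f` such that `p ≤ f p ≥ c` for a fixed element `c` has a
contractible order complex. -/
theorem contractibleSpace_orderComplex [Finite P] {f : P → P} (hf : Monotone f)
    (hle : ∀ p, p ≤ f p) {c : P} (hc : ∀ p, c ≤ f p) : ContractibleSpace (orderComplex P) := by
  classical
  have := Fintype.ofFinite P
  have nonneg (w : orderComplex P) := (mem_orderComplex.1 w.2).1
  have sum_eq (w : orderComplex P) := (mem_orderComplex.1 w.2).2.1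
  have hpush (w : orderComplex P) : pushWeight f w ∈ orderComplex P := by
    simpa using lineMap_push_mem_orderComplex hf hc le_rfl zero_le_one w.2
  have hpoint : (fun r => if c = r then 1 else 0) ∈ orderComplex P := by
    refine mem_orderComplex.2 ⟨fun p => by split_ifs <;> simp, by simp, ?_⟩
    refine Set.Subsingleton.isChain fun a ha b hb => ?_
    have ha : c = a := by simpa [eq_comm] using ha
    have hb : c = b := by simpa [eq_comm] using hb
    exact ha.symm.trans hb
  let g : C(orderComplex P, orderComplex P) :=
    ⟨fun w => ⟨pushWeight f w, hpush w⟩, Continuous.subtype_mk (continuous_pi fun r =>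
      (continuous_pushWeight f r).comp continuous_subtype_val) _⟩
  let toPush : (ContinuousMap.id (orderComplex P)).Homotopy g :=
    { toFun := fun x => ⟨_, topWeight_push_mem_orderComplex hf hle x.1 x.2.2⟩
      continuous_toFun := by
        refine Continuous.subtype_mk (continuous_pi fun r => ?_) _
        have htop : ∀ p, Continuous fun x : unitInterval × orderComplex P =>
            topWeight (x.1 : ℝ) (x.2 : P → ℝ) p := fun p =>
          (continuous_topWeight p).comp (by fun_prop :
            Continuous fun x : unitInterval × orderComplex P => ((x.1 : ℝ), (x.2 : P → ℝ)))
        exact (((continuous_apply r).comp (continuous_subtype_val.comp continuous_snd)).sub (htop r)).add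
          ((continuous_pushWeight f r).comp (continuous_pi htop))
      map_zero_left := fun w => by
        have h : topWeight 0 (w : P → ℝ) = 0 := funext (topWeight_zero (nonneg w))
        ext r
        simp [h, pushWeight]
      map_one_left := fun w => by
        have h : topWeight 1 (w : P → ℝ) = w := funext (topWeight_one (nonneg w) (sum_eq w))
        ext r
        simp [h, g] }
  let toPoint : g.Homotopy (ContinuousMap.const _ ⟨_, hpoint⟩) :=
    { toFun := fun x => ⟨_, lineMap_push_mem_orderComplex hf hc x.1.2.1 x.1.2.2 x.2.2⟩
      continuous_toFun := by
        refine Continuous.subtype_mk (continuous_pi fun r => ?_) _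
        have hg : Continuous fun x : unitInterval × orderComplex P => pushWeight f x.2 r :=
          (continuous_pushWeight f r).comp (continuous_subtype_val.comp continuous_snd)
        fun_prop
      map_zero_left := fun w => by
        ext r
        simp [g]
      map_one_left := fun w => by
        ext r
        simp }
  exact (contractible_iff_id_nullhomotopic _).2 ⟨_, ⟨toPush.trans toPoint⟩⟩

end OrderComplex

/-- The pairs of `S` with an element strictly between their entries. -/
def nonAdjacentRel {X : Type*} (S : Set (X × X)) : Set (X × X) :=
  {p | ∃ c, (p.1, c) ∈ S ∧ p.1 ≠ c ∧ (c, p.2) ∈ S ∧ c ≠ p.2}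

theorem nonAdjacentRel_subset {X : Type*} {S : Set (X × X)} (hS : IsOrder S) :
    nonAdjacentRel S ⊆ S := fun _ ⟨_, h₁, _, h₂, _⟩ => hS.2.1 _ _ _ h₁ h₂

theorem IsOrder.union_nonAdjacentRel {X : Type*} {S T : Set (X × X)} (hS : IsOrder S)
    (hT : IsOrder T) (hTS : T ⊆ S) : IsOrder (T ∪ nonAdjacentRel S) := by
  have hsub : T ∪ nonAdjacentRel S ⊆ S := Set.union_subset hTS (nonAdjacentRel_subset hS)
  refine ⟨fun x => .inl (hT.1 x), fun a b c hab hbc => ?_,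
    fun a b hab hba => hS.2.2 a b (hsub hab) (hsub hba)⟩
  by_cases h₁ : a = b
  · exact h₁ ▸ hbc
  by_cases h₂ : b = c
  · exact h₂ ▸ hab
  exact .inr ⟨b, hsub hab, h₁, hsub hbc, h₂⟩

/-- On a finite set, an order is generated by its adjacent pairs. -/
theorem IsOrder.subset_of_subset_union_nonAdjacentRel {X : Type*} [Finite X] {S T : Set (X × X)}
    (hS : IsOrder S) (hT : IsOrder T) (h : S ⊆ T ∪ nonAdjacentRel S) : S ⊆ T := by
  suffices H : ∀ n a b, {z | (a, z) ∈ S ∧ (z, b) ∈ S}.ncard = n → (a, b) ∈ S → (a, b) ∈ T from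
    fun p hp => H _ p.1 p.2 rfl hp
  intro n
  induction n using Nat.strong_induction_on with
  | _ n ih =>
    rintro a b rfl hab
    obtain h' | ⟨c, hac, hac', hcb, hcb'⟩ := h hab
    · exact h'
    refine hT.2.1 a c b (ih _ ?_ a c rfl hac) (ih _ ?_ c b rfl hcb)
    · refine Set.ncard_lt_ncard ⟨fun z hz => ⟨hz.1, hS.2.1 _ _ _ hz.2 hcb⟩, fun hs => ?_⟩
        (Set.toFinite _)
      exact hcb' (hS.2.2 _ _ hcb (hs ⟨hab, hS.1 b⟩).2)
    · refine Set.ncard_lt_ncard ⟨fun z hz => ⟨hS.2.1 _ _ _ hac hz.1, hz.2⟩, fun hs => ?_⟩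
        (Set.toFinite _)
      exact hac' (hS.2.2 _ _ hac (hs ⟨hS.1 a, hab⟩).1)

theorem IsOrder.union_nonAdjacentRel_ssubset {X : Type*} [Finite X] {S T : Set (X × X)}
    (hS : IsOrder S) (hT : IsOrder T) (hTS : T ⊂ S) : T ∪ nonAdjacentRel S ⊂ S :=
  ⟨Set.union_subset hTS.1 (nonAdjacentRel_subset hS),
    fun h => hTS.2 (hS.subset_of_subset_union_nonAdjacentRel hT h)⟩

/-- Theorem 4.1(1): if `Φ(S) ⊄ R`, i.e. there are `x <_S y <_S z` with `(x, z) ∉ R`,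
then the open interval `]R, S[` in the poset of posets is contractible. -/
theorem interval_contractible_of_not_frattini_le {X : Type*} [Fintype X]
    (R S : Set (X × X)) (hR : IsOrder R) (hS : IsOrder S) (hRS : R ⊆ S)
    (x y z : X) (hxy : (x, y) ∈ S) (hxy' : x ≠ y)
    (hyz : (y, z) ∈ S) (hyz' : y ≠ z) (hxz : (x, z) ∉ R) :
    ContractibleSpace (orderComplex {T : Set (X × X) // IsOrder T ∧ R ⊂ T ∧ T ⊂ S}) := by
  have hmem : (x, z) ∈ nonAdjacentRel S := ⟨y, hxy, hxy', hyz, hyz'⟩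
  have hRS' : R ⊂ S := ⟨hRS, fun h => hxz (h (nonAdjacentRel_subset hS hmem))⟩
  let f (T : {T : Set (X × X) // IsOrder T ∧ R ⊂ T ∧ T ⊂ S}) :
      {T : Set (X × X) // IsOrder T ∧ R ⊂ T ∧ T ⊂ S} :=
    ⟨T.1 ∪ nonAdjacentRel S, hS.union_nonAdjacentRel T.2.1 T.2.2.2.1,
      T.2.2.1.trans_subset Set.subset_union_left,
      hS.union_nonAdjacentRel_ssubset T.2.1 T.2.2.2⟩
  let c : {T : Set (X × X) // IsOrder T ∧ R ⊂ T ∧ T ⊂ S} :=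
    ⟨R ∪ nonAdjacentRel S, hS.union_nonAdjacentRel hR hRS,
      ⟨Set.subset_union_left, fun h => hxz (h (.inr hmem))⟩,
      hS.union_nonAdjacentRel_ssubset hR hRS'⟩
  refine contractibleSpace_orderComplex (f := f) (c := c) ?_ ?_ ?_
  · exact fun _ _ h => Set.union_subset_union_left _ h
  · exact fun _ => Set.subset_union_left
  · exact fun T => Set.union_subset_union_left _ T.2.2.1.1
end

section
/- Let R ⊆ S be orders on the finite set X with Φ(S) ⊆ R. Then every relation T with R ⊆ T ⊆ S is an order on X. -/
open scoped BigOperators ContinuousMap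

variable {X : Type*}

/-- Removing an adjacent pair from an order leaves an order. -/
theorem IsOrder.diff_adjacent {X : Type*} {S : Set (X × X)} (hS : IsOrder S) {a b : X}
    (hab : Adjacent S a b) : IsOrder (S \ {(a, b)}) := by
  obtain ⟨hrefl, htrans, hanti⟩ := hS
  obtain ⟨-, hne, hadj⟩ := hab
  refine ⟨fun x => ⟨hrefl x, fun h => ?_⟩, fun x y z hxy hyz => ⟨htrans x y z hxy.1 hyz.1, ?_⟩,
    fun x y hxy hyx => hanti x y hxy.1 hyx.1⟩
  · obtain ⟨rfl, rfl⟩ := Prod.mk.inj h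
    exact hne rfl
  · intro h
    obtain ⟨rfl, rfl⟩ := Prod.mk.inj h
    refine hadj y hxy.1 ?_ hyz.1 ?_
    · rintro rfl
      exact hyz.2 rfl
    · rintro rfl
      exact hxy.2 rfl

/-- On a finite set, an order missing some pair of `S` misses some adjacent pair of `S`. -/
theorem IsOrder.exists_adjacent_notMem {X : Type*} [Finite X] {M S : Set (X × X)}
    (hM : IsOrder M) (hS : IsOrder S) {x y : X} (hxy : (x, y) ∈ S) (hxyM : (x, y) ∉ M) :
    ∃ a b : X, Adjacent S a b ∧ (a, b) ∉ M := by
  induction hn : {w | (x, w) ∈ S ∧ (w, y) ∈ S}.ncard using Nat.strong_induction_on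
    generalizing x y with
  | _ n ih =>
  subst hn
  by_cases hadj : Adjacent S x y
  · exact ⟨x, y, hadj, hxyM⟩
  have hne : x ≠ y := by
    rintro rfl
    exact hxyM (hM.1 x)
  obtain ⟨z, hxz, hxz', hzy, hzy'⟩ :
      ∃ z, (x, z) ∈ S ∧ x ≠ z ∧ (z, y) ∈ S ∧ z ≠ y := by
    by_contra! h
    exact hadj ⟨hxy, hne, fun z h₁ h₂ h₃ h₄ => h₄ (h z h₁ h₂ h₃)⟩
  by_cases hxzM : (x, z) ∈ M
  · refine ih _ (Set.ncard_lt_ncard ?_ (Set.toFinite _)) hzy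
      (fun hzyM => hxyM (hM.2.1 x z y hxzM hzyM)) rfl
    refine ⟨fun w hw => ⟨hS.2.1 x z w hxz hw.1, hw.2⟩, fun h => hxz' ?_⟩
    exact hS.2.2 x z hxz (h ⟨hS.1 x, hxy⟩).1
  · refine ih _ (Set.ncard_lt_ncard ?_ (Set.toFinite _)) hxz hxzM rfl
    refine ⟨fun w hw => ⟨hw.1, hS.2.1 w z y hw.2 hzy⟩, fun h => hzy' ?_⟩
    exact hS.2.2 z y hzy (h ⟨hxy, hS.1 y⟩).2

/-- The composite of two strict comparabilities of `S` lies in the Frattini subrelation. -/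
theorem IsOrder.mem_frattiniRel {X : Type*} [Finite X] {S : Set (X × X)} (hS : IsOrder S)
    {x y z : X} (hxy : (x, y) ∈ S) (hxy' : x ≠ y) (hyz : (y, z) ∈ S) (hyz' : y ≠ z) :
    (x, z) ∈ frattiniRel S := by
  have hxz := hS.2.1 x y z hxy hyz
  refine ⟨hxz, fun M ⟨hM, hMS, hmax⟩ => ?_⟩
  by_contra hxzM
  obtain ⟨a, b, hab, habM⟩ := hM.exists_adjacent_notMem hS hxz hxzM
  refine hmax _ (hS.diff_adjacent hab) ⟨fun p hp => ⟨hMS.1 hp, ?_⟩, fun h => ?_⟩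
    ⟨Set.sdiff_subset, fun h => (h hab.1).2 rfl⟩
  · rintro rfl
    exact habM hp
  · refine hxzM (h ⟨hxz, fun heq => ?_⟩)
    obtain ⟨rfl, rfl⟩ := Prod.mk.inj heq
    exact hab.2.2 y hxy hxy' hyz hyz'

/-- Theorem 4.1(2), first part: if `Φ(S) ⊆ R ⊆ S`, then any relation between `R` and `S`
is an order. -/
theorem isOrder_of_frattini_le {X : Type*} [Fintype X]
    (R S : Set (X × X)) (hR : IsOrder R) (hS : IsOrder S) (hRS : R ⊆ S)
    (hphi : frattiniRel S ⊆ R) (T : Set (X × X)) (hRT : R ⊆ T) (hTS : T ⊆ S) :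
    IsOrder T := by
  refine ⟨fun x => hRT (hR.1 x), fun x y z hxy hyz => ?_,
    fun x y hxy hyx => hS.2.2 x y (hTS hxy) (hTS hyx)⟩
  by_cases hxy' : x = y
  · rwa [hxy']
  by_cases hyz' : y = z
  · rwa [← hyz']
  exact hRT (hphi (hS.mem_frattiniRel (hTS hxy) hxy' (hTS hyz) hyz'))
end

section
/- Let R ⊂ S be orders on the finite set X with Φ(S) ⊆ R and |S − R| = c ≥ 2. Then the open interval ]R,S[ = {T ∈ Ω_X : R ⊂ T ⊂ S} has the homotopy type of a sphere of dimension c − 2: the geometric realization of its order complex is homotopy equivalent to the sphere S^{c−2}. -/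
open scoped BigOperators ContinuousMap

variable {X : Type*}

theorem IsChain.exists_isGreatest_of_finite {P : Type*} [PartialOrder P] {C : Set P}
    (hC : IsChain (· ≤ ·) C) (hfin : C.Finite) (hne : C.Nonempty) : ∃ p, IsGreatest C p := by
  obtain ⟨p, hp⟩ := hfin.exists_maximal hne
  refine ⟨p, hp.1, fun q hq => ?_⟩
  rcases hC.total hp.1 hq with h | h
  · exact hp.2 hq h
  · exact h

theorem IsChain.exists_isLeast_of_finite {P : Type*} [PartialOrder P] {C : Set P}
    (hC : IsChain (· ≤ ·) C) (hfin : C.Finite) (hne : C.Nonempty) : ∃ p, IsLeast C p := by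
  obtain ⟨p, hp⟩ := hfin.exists_minimal hne
  refine ⟨p, hp.1, fun q hq => ?_⟩
  rcases hC.total hp.1 hq with h | h
  · exact h
  · exact hp.2 hq h

section LevelFunction

variable {P ι : Type*} [PartialOrder P] [Fintype P]

/-- The combination `∑ p, f p • 𝟙_{D p}` of indicator functions. -/
noncomputable def levelFun (D : P → Set ι) (f : P → ℝ) (i : ι) : ℝ :=
  ∑ p, f p * (D p).indicator 1 i

theorem sum_eq_one_of_mem_orderComplex {f : P → ℝ} (hf : f ∈ orderComplex P) : ∑ p, f p = 1 := by
  rw [← finsum_eq_sum_of_fintype]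
  exact hf.2.1

theorem support_nonempty_of_mem_orderComplex {f : P → ℝ} (hf : f ∈ orderComplex P) :
    {p | f p ≠ 0}.Nonempty := by
  by_contra h
  have h0 : ∀ p, f p = 0 := by simpa [Set.Nonempty] using h
  simpa [h0] using sum_eq_one_of_mem_orderComplex hf

theorem levelFun_nonneg (D : P → Set ι) {f : P → ℝ} (hf : f ∈ orderComplex P) (i : ι) :
    0 ≤ levelFun D f i :=
  Finset.sum_nonneg fun p _ =>
    mul_nonneg (hf.1 p) (Set.indicator_nonneg (fun _ _ => zero_le_one) i)

theorem levelFun_le_one (D : P → Set ι) {f : P → ℝ} (hf : f ∈ orderComplex P) (i : ι) :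
    levelFun D f i ≤ 1 := by
  rw [← sum_eq_one_of_mem_orderComplex hf]
  exact Finset.sum_le_sum fun p _ => mul_le_of_le_one_right (hf.1 p)
    (Set.indicator_le_self' (fun _ _ => zero_le_one) i)

theorem exists_levelFun_eq_one (D : P ↪o Set ι) (hne : ∀ p, (D p).Nonempty) {f : P → ℝ}
    (hf : f ∈ orderComplex P) : ∃ i, levelFun D f i = 1 := by
  obtain ⟨p, -, hmin⟩ := hf.2.2.exists_isLeast_of_finite (Set.toFinite _)
    (support_nonempty_of_mem_orderComplex hf)
  obtain ⟨i, hi⟩ := hne p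
  refine ⟨i, ?_⟩
  rw [← sum_eq_one_of_mem_orderComplex hf]
  refine Finset.sum_congr rfl fun q _ => ?_
  by_cases hq : f q = 0
  · simp [hq]
  · simp [Set.indicator_of_mem (D.monotone (hmin hq) hi)]

theorem exists_levelFun_eq_zero (D : P ↪o Set ι) (hne : ∀ p, D p ≠ Set.univ) {f : P → ℝ}
    (hf : f ∈ orderComplex P) : ∃ i, levelFun D f i = 0 := by
  obtain ⟨p, -, hmax⟩ := hf.2.2.exists_isGreatest_of_finite (Set.toFinite _)
    (support_nonempty_of_mem_orderComplex hf)
  obtain ⟨i, hi⟩ := (Set.ne_univ_iff_exists_notMem _).1 (hne p)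
  refine ⟨i, Finset.sum_eq_zero fun q _ => ?_⟩
  by_cases hq : f q = 0
  · simp [hq]
  · simp [Set.indicator_of_notMem fun h => hi (D.monotone (hmax hq) h)]

theorem levelFun_lt_of_mem_of_notMem (D : P ↪o Set ι) {f : P → ℝ} (hf : f ∈ orderComplex P)
    {p : P} (hp : f p ≠ 0) {i k : ι} (hi : i ∈ D p) (hk : k ∉ D p) :
    levelFun D f k < levelFun D f i := by
  refine Finset.sum_lt_sum (fun q _ => ?_) ⟨p, Finset.mem_univ p, ?_⟩
  · by_cases hq : f q = 0
    · simp [hq]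
    refine mul_le_mul_of_nonneg_left ?_ (hf.1 q)
    rcases hf.2.2.total hp hq with h | h
    · rw [Set.indicator_of_mem (D.monotone h hi)]
      exact Set.indicator_le_self' (fun _ _ => zero_le_one) k
    · rw [Set.indicator_of_notMem fun h' => hk (D.monotone h h')]
      exact Set.indicator_nonneg (fun _ _ => zero_le_one) i
  · simpa [hi, hk] using lt_of_le_of_ne (hf.1 p) hp.symm

theorem le_total_of_levelFun_eq (D : P ↪o Set ι) {f g : P → ℝ} (hf : f ∈ orderComplex P)
    (hg : g ∈ orderComplex P) (h : levelFun D f = levelFun D g) {p q : P} (hp : f p ≠ 0)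
    (hq : g q ≠ 0) : p ≤ q ∨ q ≤ p := by
  rw [← D.le_iff_le, ← D.le_iff_le (a := q)]
  by_contra! hc
  obtain ⟨i, hip, hiq⟩ := Set.not_subset.1 hc.1
  obtain ⟨k, hkq, hkp⟩ := Set.not_subset.1 hc.2
  have h₁ := levelFun_lt_of_mem_of_notMem D hf hp hip hkp
  have h₂ := levelFun_lt_of_mem_of_notMem D hg hq hkq hiq
  rw [h] at h₁
  exact lt_asymm h₁ h₂

theorem eq_zero_of_levelFun_eq_zero (D : P ↪o Set ι) (hne : ∀ p, (D p).Nonempty) {f : P → ℝ}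
    (hf : IsChain (· ≤ ·) {p | f p ≠ 0}) (h : levelFun D f = 0) : f = 0 := by
  by_contra hf0
  obtain ⟨p, hp, hmax⟩ := hf.exists_isGreatest_of_finite (Set.toFinite _)
    (Function.ne_iff.1 hf0)
  obtain ⟨i, hip, hi⟩ : ∃ i ∈ D p, ∀ q, f q ≠ 0 → q ≠ p → i ∉ D q := by
    rcases ({q | f q ≠ 0} \ {p}).eq_empty_or_nonempty with he | hn
    · obtain ⟨i, hi⟩ := hne p
      refine ⟨i, hi, fun q hq hqp => ?_⟩
      exact absurd (show q ∈ {q | f q ≠ 0} \ {p} from ⟨hq, hqp⟩) (by simp [he])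
    · obtain ⟨r, hr, hrmax⟩ :=
        (hf.mono Set.sdiff_subset).exists_isGreatest_of_finite (Set.toFinite _) hn
      have hrp : ¬ D p ≤ D r := fun hpr =>
        hr.2 (le_antisymm (hmax hr.1) (D.le_iff_le.1 hpr))
      obtain ⟨i, hip, hir⟩ := Set.not_subset.1 hrp
      exact ⟨i, hip, fun q hq hqp hiq => hir (D.monotone (hrmax ⟨hq, hqp⟩) hiq)⟩
  have hsum : levelFun D f i = f p := by
    rw [levelFun, Finset.sum_eq_single p]
    · simp [hip]
    · intro q _ hqp
      by_cases hq : f q = 0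
      · simp [hq]
      · simp [hi q hq hqp]
    · simp
  exact hp (by rw [← hsum, h]; rfl)

theorem levelFun_injOn (D : P ↪o Set ι) (hne : ∀ p, (D p).Nonempty) :
    Set.InjOn (levelFun D) (orderComplex P) := by
  intro f hf g hg h
  refine sub_eq_zero.1 (eq_zero_of_levelFun_eq_zero D hne ?_ ?_)
  · intro p hp q hq _
    have key : ∀ r, (f - g) r ≠ 0 → f r ≠ 0 ∨ g r ≠ 0 := by
      intro r hr
      by_contra! hc
      simp [hc] at hr
    rcases key p hp with hp | hp <;> rcases key q hq with hq | hq
    · exact hf.2.2.total hp hq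
    · exact le_total_of_levelFun_eq D hf hg h hp hq
    · exact le_total_of_levelFun_eq D hg hf h.symm hp hq
    · exact hg.2.2.total hp hq
  · funext i
    have := congrFun h i
    simp only [levelFun] at this
    simp [levelFun, sub_mul, this]

/-- The weight of `p` is the length of the set of `t ∈ [0, 1)` whose strict superlevel set
is `D p`. -/
theorem exists_levelFun_eq [Finite ι] (D : P ↪o Set ι)
    (hD : ∀ A : Set ι, A.Nonempty → A ≠ Set.univ → A ∈ Set.range D) {v : ι → ℝ}
    (h0 : ∀ i, 0 ≤ v i) (h1 : ∀ i, v i ≤ 1) (hmin : ∃ i, v i = 0) (hmax : ∃ i, v i = 1) :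
    ∃ f ∈ orderComplex P, levelFun D f = v := by
  classical
  let E : P → Set ℝ := fun p => {t | t ∈ Set.Ico 0 1 ∧ {i | t < v i} = D p}
  have hE : ∀ p, MeasurableSet (E p) := by
    intro p
    have : E p = Set.Ico 0 1 ∩ ⋂ i, {t | t < v i ↔ i ∈ D p} := by
      ext t
      simp [E, Set.ext_iff]
    rw [this]
    refine measurableSet_Ico.inter (MeasurableSet.iInter fun i => ?_)
    by_cases hi : i ∈ D p
    · simp only [hi, iff_true]
      exact measurableSet_Iio
    · simp only [hi, iff_false, not_lt]
      exact measurableSet_Ici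
  have hdisj : Pairwise (Function.onFun Disjoint E) := by
    intro p q hpq
    refine Set.disjoint_left.2 fun t hp hq => hpq (D.injective ?_)
    exact hp.2.symm.trans hq.2
  have hfin : ∀ p, MeasureTheory.volume (E p) ≠ ⊤ := fun p =>
    ne_top_of_le_ne_top (by simp)
      (MeasureTheory.measure_mono (t := Set.Ico (0 : ℝ) 1) fun t ht => ht.1)
  have hcover : ∀ t ∈ Set.Ico (0 : ℝ) 1, ∃ p, t ∈ E p := by
    intro t ht
    obtain ⟨i, hi⟩ := hmin
    obtain ⟨k, hk⟩ := hmax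
    obtain ⟨p, hp⟩ := hD {i | t < v i} ⟨k, by simpa [hk] using ht.2⟩
      ((Set.ne_univ_iff_exists_notMem _).2 ⟨i, by simpa [hi] using ht.1⟩)
    exact ⟨p, ht, hp.symm⟩
  have hsum : ∀ s : Finset P, ∑ p ∈ s, MeasureTheory.volume.real (E p) =
      MeasureTheory.volume.real (⋃ p ∈ s, E p) := fun s =>
    (MeasureTheory.measureReal_biUnion_finset (fun p _ q _ hpq => hdisj hpq)
      (fun p _ => hE p) (fun p _ => hfin p)).symm
  refine ⟨fun p => MeasureTheory.volume.real (E p),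
    ⟨fun p => MeasureTheory.measureReal_nonneg, ?_, ?_⟩, ?_⟩
  · rw [finsum_eq_sum_of_fintype, hsum]
    have : ⋃ p ∈ Finset.univ, E p = Set.Ico (0 : ℝ) 1 := by
      ext t
      simp only [Finset.mem_univ, Set.iUnion_true, Set.mem_iUnion]
      exact ⟨fun ⟨p, hp⟩ => hp.1, hcover t⟩
    rw [this]
    simp
  · have key : ∀ p, MeasureTheory.volume.real (E p) ≠ 0 → ∃ t, D p = {i | t < v i} := by
      intro p hp
      obtain ⟨t, ht⟩ := MeasureTheory.nonempty_of_measureReal_ne_zero hp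
      exact ⟨t, ht.2.symm⟩
    intro p hp q hq _
    obtain ⟨s, hs⟩ := key p hp
    obtain ⟨t, ht⟩ := key q hq
    beta_reduce
    rw [← D.le_iff_le, ← D.le_iff_le (a := q), hs, ht]
    rcases le_total s t with hst | hst
    · exact Or.inr fun i hi => hst.trans_lt hi
    · exact Or.inl fun i hi => hst.trans_lt hi
  · funext i
    have : ⋃ p ∈ Finset.univ.filter (i ∈ D ·), E p = Set.Ico 0 (v i) := by
      ext t
      simp only [Finset.mem_filter, Finset.mem_univ, true_and, Set.mem_iUnion, exists_prop]
      constructor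
      · rintro ⟨p, hi, ht, hp⟩
        rw [← hp] at hi
        exact ⟨ht.1, hi⟩
      · intro ht
        obtain ⟨p, hp⟩ := hcover t ⟨ht.1, ht.2.trans_le (h1 i)⟩
        refine ⟨p, ?_, hp⟩
        rw [← hp.2]
        exact ht.2
    simp only [levelFun, Set.indicator_apply, Pi.one_apply, mul_ite, mul_one, mul_zero]
    rw [← Finset.sum_filter, hsum, this]
    simp [h0 i]

theorem isCompact_orderComplex : IsCompact (orderComplex P) := by
  refine (isCompact_univ_pi fun _ : P => isCompact_Icc (a := (0 : ℝ)) (b := 1)).of_isClosed_subset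
    ?_ ?_
  · have : orderComplex P = {f | ∀ p, 0 ≤ f p} ∩ {f | ∑ p, f p = 1} ∩
        ⋂ p, ⋂ q, {f | f p * f q = 0 ∨ p ≤ q ∨ q ≤ p} := by
      ext f
      simp only [orderComplex, finsum_eq_sum_of_fintype, Set.mem_ofPred_eq, Set.mem_inter_iff,
        Set.mem_iInter, and_assoc, and_congr_right_iff]
      intro _ _
      refine ⟨fun h p q => ?_, fun h p hp q hq _ => ?_⟩
      · by_cases hp : f p = 0
        · simp [hp]
        by_cases hq : f q = 0
        · simp [hq]
        exact Or.inr (h.total hp hq)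
      · exact (h p q).resolve_left (mul_ne_zero hp hq)
    rw [this]
    refine (IsClosed.inter ?_ ?_).inter (isClosed_iInter fun p => isClosed_iInter fun q => ?_)
    · simp only [Set.ofPred_forall]
      exact isClosed_iInter fun p => isClosed_le continuous_const (continuous_apply p)
    · exact isClosed_eq (by fun_prop) continuous_const
    · by_cases hpq : p ≤ q ∨ q ≤ p
      · simp [hpq]
      · simp only [hpq, or_false]
        exact isClosed_eq (by fun_prop) continuous_const
  · intro f hf p _
    refine ⟨hf.1 p, ?_⟩
    rw [← sum_eq_one_of_mem_orderComplex hf]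
    exact Finset.single_le_sum (fun q _ => hf.1 q) (Finset.mem_univ p)

end LevelFunction

section Sphere

variable {n : ℕ}

/-- The differences of the coordinates of `v` with its first coordinate. -/
noncomputable def coordDiff (v : Fin (n + 1) → ℝ) : EuclideanSpace ℝ (Fin n) :=
  WithLp.toLp 2 fun i => v i.succ - v 0

theorem coordDiff_ne_zero {v : Fin (n + 1) → ℝ} (hmin : ∃ i, v i = 0) (hmax : ∃ i, v i = 1) :
    coordDiff v ≠ 0 := by
  intro h
  have hv : ∀ i, v i = v 0 := by
    intro i
    refine Fin.cases rfl (fun j => ?_) i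
    have := congrArg (fun u : EuclideanSpace ℝ (Fin n) => u j) h
    exact sub_eq_zero.1 (by simpa [coordDiff] using this)
  obtain ⟨i, hi⟩ := hmin
  obtain ⟨k, hk⟩ := hmax
  rw [hv] at hi hk
  linarith

theorem eq_of_coordDiff_eq_smul {v w : Fin (n + 1) → ℝ} {a : ℝ} (ha : 0 ≤ a)
    (hv : ∀ i, 0 ≤ v i ∧ v i ≤ 1) (hw : ∀ i, 0 ≤ w i ∧ w i ≤ 1)
    (hv0 : ∃ i, v i = 0) (hv1 : ∃ i, v i = 1) (hw0 : ∃ i, w i = 0) (hw1 : ∃ i, w i = 1)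
    (h : coordDiff v = a • coordDiff w) : v = w := by
  have hd : ∀ i, v i - v 0 = a * (w i - w 0) := by
    intro i
    refine Fin.cases (by simp) (fun j => ?_) i
    simpa [coordDiff] using congrArg (fun u : EuclideanSpace ℝ (Fin n) => u j) h
  obtain ⟨i, hi⟩ := hv0
  obtain ⟨j, hj⟩ := hv1
  obtain ⟨k, hk⟩ := hw0
  obtain ⟨l, hl⟩ := hw1
  have hdi := hd i
  have hdj := hd j
  have hdk := hd k
  have hdl := hd l
  have h₁ : a * (w j - w i) = 1 := by linarith
  have h₂ : a = v l - v k := by rw [hk] at hdk; rw [hl] at hdl; linarith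
  have ha1 : a = 1 := by
    have := (hv l).2
    have := (hv k).1
    have := (hw j).2
    have := (hw i).1
    nlinarith
  subst ha1
  have hvk := (hv k).1
  have hwi := (hw i).1
  funext m
  have := hd m
  linarith

theorem exists_normalize_coordDiff_eq {u : EuclideanSpace ℝ (Fin n)} (hu : ‖u‖ = 1) :
    ∃ v : Fin (n + 1) → ℝ, (∀ i, 0 ≤ v i) ∧ (∀ i, v i ≤ 1) ∧ (∃ i, v i = 0) ∧ (∃ i, v i = 1) ∧
      ‖coordDiff v‖⁻¹ • coordDiff v = u := by
  let w : Fin (n + 1) → ℝ := Fin.cons 0 fun i => u i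
  obtain ⟨i, hi⟩ := Finite.exists_min w
  obtain ⟨k, hk⟩ := Finite.exists_max w
  have hlt : w i < w k := by
    refine lt_of_le_of_ne (hi k) fun h => ?_
    have hw : ∀ j, w j = 0 := fun j => by
      have h₁ := hi j
      have h₂ := hk j
      have h₃ := hi 0
      have h₄ := hk 0
      have h₅ : w 0 = 0 := rfl
      linarith
    have : u = 0 := by
      ext j
      exact hw j.succ
    simp [this] at hu
  have hpos : 0 < w k - w i := sub_pos.2 hlt
  refine ⟨fun j => (w j - w i) / (w k - w i), fun j => ?_, fun j => ?_, ⟨i, by simp⟩,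
    ⟨k, div_self hpos.ne'⟩, ?_⟩
  · exact div_nonneg (sub_nonneg.2 (hi j)) hpos.le
  · exact (div_le_one hpos).2 (sub_le_sub_right (hk j) _)
  · have hd : coordDiff (fun j => (w j - w i) / (w k - w i)) = (w k - w i)⁻¹ • u := by
      ext j
      have h₁ : w j.succ = u j := rfl
      have h₂ : w 0 = 0 := rfl
      simp only [coordDiff, PiLp.smul_apply, smul_eq_mul, h₁, h₂]
      field_simp
      ring
    rw [hd, norm_smul, hu, norm_inv, Real.norm_of_nonneg hpos.le, mul_one, inv_inv,
      smul_inv_smul₀ hpos.ne']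

end Sphere

/-- The order complex of the proper part of a Boolean lattice on `n + 1` atoms is a sphere. -/
theorem nonempty_homeomorph_sphere {P : Type*} [PartialOrder P] [Finite P] {n : ℕ}
    (D : P ↪o Set (Fin (n + 1))) (hD : Set.range D = {A | A.Nonempty ∧ A ≠ Set.univ}) :
    Nonempty (orderComplex P ≃ₜ Metric.sphere (0 : EuclideanSpace ℝ (Fin n)) 1) := by
  have := Fintype.ofFinite P
  have hmem : ∀ p, (D p).Nonempty ∧ D p ≠ Set.univ := fun p => by
    have : D p ∈ Set.range D := ⟨p, rfl⟩
    rwa [hD] at this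
  have h1 : ∀ f ∈ orderComplex P, ∃ i, levelFun D f i = 1 := fun f hf =>
    exists_levelFun_eq_one D (fun p => (hmem p).1) hf
  have h0 : ∀ f ∈ orderComplex P, ∃ i, levelFun D f i = 0 := fun f hf =>
    exists_levelFun_eq_zero D (fun p => (hmem p).2) hf
  have hne : ∀ f ∈ orderComplex P, coordDiff (levelFun D f) ≠ 0 := fun f hf =>
    coordDiff_ne_zero (h0 f hf) (h1 f hf)
  let F : orderComplex P → Metric.sphere (0 : EuclideanSpace ℝ (Fin n)) 1 := fun f =>
    ⟨‖coordDiff (levelFun D f)‖⁻¹ • coordDiff (levelFun D f), by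
      rw [mem_sphere_zero_iff_norm, norm_smul, norm_inv, norm_norm,
        inv_mul_cancel₀ (norm_ne_zero_iff.2 (hne f f.2))]⟩
  have hcont : Continuous F := by
    have hl : ∀ i, Continuous fun f : orderComplex P => levelFun D f i := fun i =>
      continuous_finsetSum _ fun p _ =>
        ((continuous_apply p).comp continuous_subtype_val).mul continuous_const
    have hd : Continuous fun f : orderComplex P => coordDiff (levelFun D f) := by
      refine (PiLp.continuous_toLp 2 _).comp (continuous_pi fun i => ?_)
      exact (hl i.succ).sub (hl 0)
    exact Continuous.subtype_mk
      ((hd.norm.inv₀ fun f => norm_ne_zero_iff.2 (hne f f.2)).smul hd) _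
  have hbij : Function.Bijective F := by
    constructor
    · intro f g hfg
      refine Subtype.ext (levelFun_injOn D (fun p => (hmem p).1) f.2 g.2 ?_)
      refine eq_of_coordDiff_eq_smul
        (a := ‖coordDiff (levelFun D f)‖ * ‖coordDiff (levelFun D g)‖⁻¹) (by positivity)
        (fun i => ⟨levelFun_nonneg D f.2 i, levelFun_le_one D f.2 i⟩)
        (fun i => ⟨levelFun_nonneg D g.2 i, levelFun_le_one D g.2 i⟩)
        (h0 f f.2) (h1 f f.2) (h0 g g.2) (h1 g g.2) ?_
      have h := congrArg Subtype.val hfg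
      simp only [F] at h
      rw [mul_smul, ← h, smul_inv_smul₀ (norm_ne_zero_iff.2 (hne f f.2))]
    · intro u
      obtain ⟨v, hv0, hv1, hmin, hmax, hvu⟩ :=
        exists_normalize_coordDiff_eq (mem_sphere_zero_iff_norm.1 u.2)
      obtain ⟨f, hf, rfl⟩ := exists_levelFun_eq D
        (fun A hA hA' => by rw [hD]; exact ⟨hA, hA'⟩) hv0 hv1 hmin hmax
      exact ⟨⟨f, hf⟩, Subtype.ext hvu⟩
  have : CompactSpace (orderComplex P) := isCompact_iff_compactSpace.1 isCompact_orderComplex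
  exact ⟨Continuous.homeoOfEquivCompactToT2 (f := Equiv.ofBijective F hbij) hcont⟩

theorem IsOrder.diff_singleton_of_adjacent_s7 {S : Set (X × X)} (hS : IsOrder S) {a b : X}
    (hab : Adjacent S a b) : IsOrder (S \ {(a, b)}) := by
  refine ⟨fun x => ⟨hS.1 x, ?_⟩, fun x y z hxy hyz => ⟨hS.2.1 x y z hxy.1 hyz.1, ?_⟩,
    fun x y hxy hyx => hS.2.2 x y hxy.1 hyx.1⟩
  · rintro ⟨⟩
    exact hab.2.1 rfl
  · rintro ⟨⟩
    refine hab.2.2 y hxy.1 ?_ hyz.1 ?_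
    · rintro rfl
      exact hyz.2 rfl
    · rintro rfl
      exact hxy.2 rfl

/-- An order contained in a finite order `S` and containing all its adjacent pairs is `S`. -/
theorem IsOrder.subset_of_adjacent_mem [Finite X] {R S : Set (X × X)} (hR : IsOrder R)
    (hS : IsOrder S) (h : ∀ a b, Adjacent S a b → (a, b) ∈ R) : S ⊆ R := by
  have key : ∀ m : ℕ, ∀ a b, {z | (a, z) ∈ S ∧ (z, b) ∈ S}.ncard = m → (a, b) ∈ S →
      (a, b) ∈ R := by
    intro m
    induction m using Nat.strong_induction_on with
    | _ m ih =>
      rintro a b rfl hab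
      by_cases hne : a = b
      · subst hne
        exact hR.1 a
      by_cases had : Adjacent S a b
      · exact h a b had
      simp only [Adjacent, hab, hne, ne_eq, not_false_eq_true, true_and, not_forall] at had
      obtain ⟨z, haz, haz', hzb, hzb', -⟩ := had
      refine hR.2.1 a z b (ih _ (Set.ncard_lt_ncard ?_) a z rfl haz)
        (ih _ (Set.ncard_lt_ncard ?_) z b rfl hzb)
      · have hsub : {t | (a, t) ∈ S ∧ (t, z) ∈ S} ⊆ {t | (a, t) ∈ S ∧ (t, b) ∈ S} :=
          fun t ht => ⟨ht.1, hS.2.1 _ _ _ ht.2 hzb⟩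
        exact (Set.ssubset_iff_of_subset hsub).2
          ⟨b, ⟨hab, hS.1 b⟩, fun hb => hzb' (hS.2.2 _ _ hzb hb.2)⟩
      · have hsub : {t | (z, t) ∈ S ∧ (t, b) ∈ S} ⊆ {t | (a, t) ∈ S ∧ (t, b) ∈ S} :=
          fun t ht => ⟨hS.2.1 _ _ _ haz ht.1, ht.2⟩
        exact (Set.ssubset_iff_of_subset hsub).2
          ⟨a, ⟨hS.1 a, hab⟩, fun ha => haz' (hS.2.2 _ _ haz ha.1)⟩
  exact fun p hp => key _ p.1 p.2 rfl hp

theorem mem_frattiniRel_of_lt_of_lt [Finite X] {S : Set (X × X)} (hS : IsOrder S) {x y z : X}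
    (hxz : (x, z) ∈ S) (hzy : (z, y) ∈ S) (hne : x ≠ z) (hne' : z ≠ y) :
    (x, y) ∈ frattiniRel S := by
  refine ⟨hS.2.1 _ _ _ hxz hzy, fun M hM => ?_⟩
  obtain ⟨a, b, hab, habM⟩ : ∃ a b, Adjacent S a b ∧ (a, b) ∉ M := by
    by_contra! hc
    exact hM.2.1.2 (hM.1.subset_of_adjacent_mem hS hc)
  by_contra hxy
  have hsub : M ⊆ S \ {(a, b)} := fun p hp => ⟨hM.2.1.1 hp, fun h => habM (h ▸ hp)⟩
  have hlt : S \ {(a, b)} ⊂ S :=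
    (Set.ssubset_iff_of_subset Set.sdiff_subset).2 ⟨(a, b), hab.1, fun h => h.2 rfl⟩
  by_cases hxyab : (x, y) = (a, b)
  · obtain ⟨rfl, rfl⟩ := Prod.mk.inj hxyab
    exact hab.2.2 z hxz hne hzy hne'
  · exact hM.2.2 _ (hS.diff_singleton_of_adjacent_s7 hab)
      ((Set.ssubset_iff_of_subset hsub).2
        ⟨(x, y), ⟨hS.2.1 _ _ _ hxz hzy, hxyab⟩, hxy⟩) hlt

theorem IsOrder.of_frattiniRel_subset [Finite X] {R S T : Set (X × X)} (hR : IsOrder R)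
    (hS : IsOrder S) (hphi : frattiniRel S ⊆ R) (hRT : R ⊆ T) (hTS : T ⊆ S) : IsOrder T := by
  refine ⟨fun x => hRT (hR.1 x), fun x y z hxy hyz => ?_,
    fun x y hxy hyx => hS.2.2 x y (hTS hxy) (hTS hyx)⟩
  by_cases h : x = y
  · exact h ▸ hyz
  by_cases h' : y = z
  · exact h' ▸ hxy
  exact hRT (hphi (mem_frattiniRel_of_lt_of_lt hS (hTS hxy) (hTS hyz) h h'))

/-- Theorem 4.1(2), homotopy type: if `Φ(S) ⊆ R ⊂ S` and `|S − R| = c ≥ 2`, then the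
interval `]R, S[` has the homotopy type of a sphere of dimension `c − 2`. -/
theorem interval_homotopyEquiv_sphere {X : Type*} [Fintype X]
    (R S : Set (X × X)) (hR : IsOrder R) (hS : IsOrder S) (hRS : R ⊂ S)
    (hphi : frattiniRel S ⊆ R) (c : ℕ) (hc : 2 ≤ c) (hcard : (S \ R).ncard = c) :
    Nonempty ((orderComplex {T : Set (X × X) // IsOrder T ∧ R ⊂ T ∧ T ⊂ S}) ≃ₕ
      (Metric.sphere (0 : EuclideanSpace ℝ (Fin (c - 1))) 1)) := by
  obtain ⟨n, rfl⟩ : ∃ n, c = n + 1 := ⟨c - 1, by omega⟩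
  have hcard' : Nat.card (S \ R : Set (X × X)) = n + 1 := hcard
  let e : (S \ R : Set (X × X)) ≃ Fin (n + 1) := Finite.equivFinOfCardEq hcard'
  let D : {T : Set (X × X) // IsOrder T ∧ R ⊂ T ∧ T ⊂ S} ↪o Set (Fin (n + 1)) :=
    OrderEmbedding.ofMapLEIff (fun T => {i | (e.symm i : X × X) ∈ T.1}) (by
      intro T U
      refine ⟨fun h p hp => ?_, fun h i hi => h hi⟩
      by_cases hpR : p ∈ R
      · exact U.2.2.1.1 hpR
      · have := @h (e ⟨p, T.2.2.2.1 hp, hpR⟩) (by simpa using hp)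
        simpa using this)
  have hD : Set.range D = {A | A.Nonempty ∧ A ≠ Set.univ} := by
    ext A
    constructor
    · rintro ⟨T, rfl⟩
      obtain ⟨p, hpT, hpR⟩ := Set.exists_of_ssubset T.2.2.1
      obtain ⟨q, hqS, hqT⟩ := Set.exists_of_ssubset T.2.2.2
      refine ⟨⟨e ⟨p, T.2.2.2.1 hpT, hpR⟩, by simpa [D] using hpT⟩,
        (Set.ne_univ_iff_exists_notMem _).2
          ⟨e ⟨q, hqS, fun hqR => hqT (T.2.2.1.1 hqR)⟩, by simpa [D] using hqT⟩⟩
    · rintro ⟨⟨i, hi⟩, hA⟩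
      obtain ⟨k, hk⟩ := (Set.ne_univ_iff_exists_notMem _).1 hA
      let T : Set (X × X) := R ∪ {p | ∃ j ∈ A, (e.symm j : X × X) = p}
      have hT : ∀ j, (e.symm j : X × X) ∈ T ↔ j ∈ A := by
        intro j
        refine ⟨?_, fun hj => Or.inr ⟨j, hj, rfl⟩⟩
        rintro (h | ⟨l, hl, h⟩)
        · exact absurd h (e.symm j).2.2
        · rwa [← e.symm.injective (Subtype.ext h)]
      have hRT : R ⊆ T := Set.subset_union_left
      have hTS : T ⊆ S := by
        rintro p (h | ⟨l, -, rfl⟩)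
        · exact hRS.1 h
        · exact (e.symm l).2.1
      refine ⟨⟨T, hR.of_frattiniRel_subset hS hphi hRT hTS, ?_, ?_⟩, Set.ext hT⟩
      · exact (Set.ssubset_iff_of_subset hRT).2 ⟨_, (hT i).2 hi, (e.symm i).2.2⟩
      · exact (Set.ssubset_iff_of_subset hTS).2 ⟨_, (e.symm k).2.1, fun h => hk ((hT k).1 h)⟩
  obtain ⟨h⟩ := nonempty_homeomorph_sphere D hD
  exact ⟨h.toHomotopyEquiv⟩
end

section
/- Let R be an order on the finite set X and (a,b) ∈ X × X. Then (a,b) is a minimal element of (X × X) − (R ∪ R^op) for the relation R^(2) if and only if (a,b) ∉ R ∪ R^op, ]·,a[_R ⊆ ]·,b[_R, and ]b,·[_R ⊆ ]a,·[_R. -/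
open scoped BigOperators ContinuousMap

variable {X : Type*}

/-- Lemma 5.1: `(a, b)` is a minimal element of `(X × X) − (R ∪ R^op)` for `R^(2)` iff
`(a, b) ∉ R ∪ R^op`, `]·, a[_R ⊆ ]·, b[_R` and `]b, ·[_R ⊆ ]a, ·[_R`. -/
theorem minimalPair_iff {X : Type*} [Fintype X]
    (R : Set (X × X)) (hR : IsOrder R) (a b : X) :
    MinimalPair R (a, b) ↔
      ((a, b) ∉ R ∪ opRel R ∧ lowerSet R a ⊆ lowerSet R b ∧ upperSet R b ⊆ upperSet R a) := by
  obtain ⟨hrefl, htrans, -⟩ := hR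
  constructor
  · rintro ⟨hab, hmin⟩
    refine ⟨hab, ?_, ?_⟩
    · rintro z ⟨hza, hne⟩
      have hzb : (z, b) ∈ R := by
        by_contra hzb
        have hbz : (b, z) ∉ R := fun hbz => hab (Or.inr (htrans _ _ _ hbz hza))
        have := hmin (z, b) (fun h => h.elim hzb hbz) ⟨hza, hrefl b⟩
        exact hne (congrArg Prod.fst this)
      exact ⟨hzb, fun h => hab (Or.inr (h ▸ hza))⟩
    · rintro z ⟨hbz, hne⟩
      have haz : (a, z) ∈ R := by
        by_contra haz
        have hza : (z, a) ∉ R := fun hza => hab (Or.inr (htrans _ _ _ hbz hza))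
        have := hmin (a, z) (fun h => h.elim haz hza) ⟨hrefl a, hbz⟩
        exact hne (congrArg Prod.snd this).symm
      exact ⟨haz, fun h => hab (Or.inr (h ▸ hbz))⟩
  · rintro ⟨hab, hlower, hupper⟩
    refine ⟨hab, ?_⟩
    rintro ⟨x, y⟩ hxy ⟨hxa, hby⟩
    obtain rfl : x = a := by
      by_contra hne
      exact hxy (Or.inl (htrans _ _ _ (hlower ⟨hxa, hne⟩).1 hby))
    obtain rfl : b = y := by
      by_contra hne
      exact hxy (Or.inl (hupper ⟨hby, hne⟩).1)
    rfl
end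

section
/- Let R be an order on the finite set X such that 𝓔_R = (𝓔_R)^op. Then E_R = Δ ∪ 𝓔_R is an equivalence relation on X (reflexive, symmetric and transitive), and moreover (a,b) ∈ E_R if and only if ]·,a[_R = ]·,b[_R and ]a,·[_R = ]b,·[_R. -/
open scoped BigOperators ContinuousMap

variable {X : Type*}

/-- Elements with the same strict lower and upper sets are equal or form a pair of `𝓔_R`. -/
theorem mem_delta_union_eSet_of_eq {R : Set (X × X)} {a b : X}
    (hl : lowerSet R a = lowerSet R b) (hu : upperSet R a = upperSet R b) :
    (a, b) ∈ delta X ∪ eSet R := by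
  by_cases hab : a = b
  · exact Or.inl hab
  · refine Or.inr ⟨?_, hl.subset, hu.superset⟩
    rintro (h | h)
    · have ha : a ∈ lowerSet R a := hl ▸ (⟨h, hab⟩ : a ∈ lowerSet R b)
      exact ha.2 rfl
    · have hb : b ∈ lowerSet R b := hl ▸ (⟨h, Ne.symm hab⟩ : b ∈ lowerSet R a)
      exact hb.2 rfl

/-- If `𝓔_R` is symmetric, then `Δ ∪ 𝓔_R` is equality of strict lower and upper sets. -/
theorem mem_delta_union_eSet_iff {R : Set (X × X)} (hsym : eSet R = opRel (eSet R)) (a b : X) :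
    (a, b) ∈ delta X ∪ eSet R ↔
      (lowerSet R a = lowerSet R b ∧ upperSet R a = upperSet R b) := by
  refine ⟨?_, fun h => mem_delta_union_eSet_of_eq h.1 h.2⟩
  rintro (h | h)
  · obtain rfl : a = b := h
    exact ⟨rfl, rfl⟩
  · have h' : (b, a) ∈ eSet R := hsym.subset h
    exact ⟨h.2.1.antisymm h'.2.1, h'.2.2.antisymm h.2.2⟩

/-- Theorem 5.3(2), first part: if `𝓔_R = (𝓔_R)^op`, then `E_R = Δ ∪ 𝓔_R` is an
equivalence relation on `X`, and `(a, b) ∈ E_R` iff `]·, a[_R = ]·, b[_R` and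
`]a, ·[_R = ]b, ·[_R`. -/
theorem eRel_equivalence {X : Type*} [Fintype X]
    (R : Set (X × X)) (hR : IsOrder R) (hsym : eSet R = opRel (eSet R)) :
    (∀ a : X, (a, a) ∈ delta X ∪ eSet R) ∧
    (∀ a b : X, (a, b) ∈ delta X ∪ eSet R → (b, a) ∈ delta X ∪ eSet R) ∧
    (∀ a b c : X, (a, b) ∈ delta X ∪ eSet R → (b, c) ∈ delta X ∪ eSet R →
      (a, c) ∈ delta X ∪ eSet R) ∧
    (∀ a b : X, (a, b) ∈ delta X ∪ eSet R ↔
      (lowerSet R a = lowerSet R b ∧ upperSet R a = upperSet R b)) := by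
  have key := mem_delta_union_eSet_iff hsym
  refine ⟨fun a => Or.inl rfl, fun a b h => ?_, fun a b c h₁ h₂ => ?_, key⟩
  · rw [key] at h ⊢
    exact ⟨h.1.symm, h.2.symm⟩
  · rw [key] at h₁ h₂ ⊢
    exact ⟨h₁.1.trans h₂.1, h₁.2.trans h₂.2⟩
end

section
/- Let R be an order on the finite set X, and suppose there exists a pair (a,b) ∈ 𝓔_R with (b,a) ∉ 𝓔_R. Then the poset ]R,·[ = {T ∈ Ω_X : R ⊂ T} of orders strictly containing R is contractible: the geometric realization of its order complex is a contractible topological space. -/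
open scoped BigOperators ContinuousMap

variable {X : Type*}

section OrderComplex

variable {P : Type*} [PartialOrder P] [Fintype P]

theorem mem_orderComplex_iff {f : P → ℝ} :
    f ∈ orderComplex P ↔
      (∀ p, 0 ≤ f p) ∧ ∑ p, f p = 1 ∧ IsChain (· ≤ ·) {p | f p ≠ 0} := by
  simp only [orderComplex, Set.mem_ofPred_eq, finsum_eq_sum_of_fintype]

/-- Two maps into an order complex are homotopic along straight lines as soon as their values
have supports contained in a common chain. -/
theorem homotopic_of_isChain_union {Y : Type*} [TopologicalSpace Y] (F G : C(Y, orderComplex P))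
    (h : ∀ y, IsChain (· ≤ ·) ({p | (F y).1 p ≠ 0} ∪ {p | (G y).1 p ≠ 0})) :
    F.Homotopic G := by
  refine ⟨⟨⟨fun z => ⟨fun p => (1 - (z.1 : ℝ)) * (F z.2).1 p + z.1 * (G z.2).1 p, ?_⟩, ?_⟩, ?_, ?_⟩⟩
  · obtain ⟨hF0, hF1, -⟩ := mem_orderComplex_iff.1 (F z.2).2
    obtain ⟨hG0, hG1, -⟩ := mem_orderComplex_iff.1 (G z.2).2
    refine mem_orderComplex_iff.2 ⟨fun p => ?_, ?_, (h z.2).mono fun p hp => ?_⟩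
    · have := mul_nonneg (sub_nonneg.2 z.1.2.2) (hF0 p)
      have := mul_nonneg z.1.2.1 (hG0 p)
      linarith
    · rw [Finset.sum_add_distrib, ← Finset.mul_sum, ← Finset.mul_sum, hF1, hG1]
      ring
    · by_contra hn
      simp only [Set.mem_union, Set.mem_ofPred_eq, not_or, not_not] at hn
      exact hp (by simp [hn.1, hn.2])
  · refine Continuous.subtype_mk (continuous_pi fun p => ?_) _
    have hF : Continuous fun z : unitInterval × Y => (F z.2).1 p :=
      (continuous_apply p).comp (continuous_subtype_val.comp (F.continuous.comp continuous_snd))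
    have hG : Continuous fun z : unitInterval × Y => (G z.2).1 p :=
      (continuous_apply p).comp (continuous_subtype_val.comp (G.continuous.comp continuous_snd))
    have ht : Continuous fun z : unitInterval × Y => (z.1 : ℝ) :=
      continuous_subtype_val.comp continuous_fst
    exact ((continuous_const.sub ht).mul hF).add (ht.mul hG)
  · intro y
    ext p
    simp
  · intro y
    ext p
    simp

open Classical in
/-- The total mass of `f` strictly above `x`. -/
noncomputable def massAbove (f : P → ℝ) (x : P) : ℝ := ∑ y, if x < y then f y else 0

/-- The part of the mass of `f` at `x` belonging to the top `τ` of the mass of `f`. -/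
noncomputable def topPart (f : P → ℝ) (τ : ℝ) (x : P) : ℝ :=
  max 0 (min (f x) (τ - massAbove f x))

open Classical in
/-- Move the top `τ` of the mass of `f` along the map `θ`. -/
noncomputable def prism (θ : P → P) (f : P → ℝ) (τ : ℝ) (y : P) : ℝ :=
  (f y - topPart f τ y) + ∑ x, if θ x = y then topPart f τ x else 0

theorem massAbove_nonneg {f : P → ℝ} (hf : ∀ p, 0 ≤ f p) (x : P) : 0 ≤ massAbove f x :=
  Finset.sum_nonneg fun y _ => by split_ifs <;> simp [hf]

theorem add_massAbove_le_sum {f : P → ℝ} (hf : ∀ p, 0 ≤ f p) (x : P) :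
    f x + massAbove f x ≤ ∑ y, f y := by
  classical
  have h : ∑ y, (if y = x then f y else 0) = f x := by simp
  rw [← h, massAbove, ← Finset.sum_add_distrib]
  refine Finset.sum_le_sum fun y _ => ?_
  by_cases hy : y = x
  · simp [hy]
  · by_cases hxy : x < y <;> simp [hy, hxy, hf]

theorem add_massAbove_le_massAbove {f : P → ℝ} (hf : ∀ p, 0 ≤ f p) {x y : P} (hxy : y < x) :
    f x + massAbove f x ≤ massAbove f y := by
  classical
  have h : ∑ z, (if z = x then f z else 0) = f x := by simp
  rw [← h, massAbove, massAbove, ← Finset.sum_add_distrib]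
  refine Finset.sum_le_sum fun z _ => ?_
  by_cases hz : z = x
  · simp [hz, hxy]
  · by_cases hxz : x < z
    · simp [hz, hxz, hxy.trans hxz]
    · by_cases hyz : y < z <;> simp [hz, hxz, hyz, hf]

theorem topPart_nonneg (f : P → ℝ) (τ : ℝ) (x : P) : 0 ≤ topPart f τ x := le_max_left _ _

theorem topPart_le {f : P → ℝ} (hf : ∀ p, 0 ≤ f p) (τ : ℝ) (x : P) : topPart f τ x ≤ f x :=
  max_le (hf x) (min_le_left _ _)

theorem topPart_eq_zero {f : P → ℝ} (hf : ∀ p, 0 ≤ f p) {τ : ℝ} {x : P} (hx : f x = 0) :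
    topPart f τ x = 0 :=
  le_antisymm (hx ▸ topPart_le hf τ x) (topPart_nonneg f τ x)

theorem topPart_zero {f : P → ℝ} (hf : ∀ p, 0 ≤ f p) (x : P) : topPart f 0 x = 0 :=
  max_eq_left (min_le_of_right_le (by linarith [massAbove_nonneg hf x]))

theorem topPart_one {f : P → ℝ} (hf : f ∈ orderComplex P) (x : P) : topPart f 1 x = f x := by
  obtain ⟨h0, h1, -⟩ := mem_orderComplex_iff.1 hf
  have := add_massAbove_le_sum h0 x
  rw [topPart, min_eq_left (by linarith), max_eq_right (h0 x)]

/-- Mass that is not moved lies below mass that is moved, within a chain. -/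
theorem not_lt_of_topPart {f : P → ℝ} (hf : ∀ p, 0 ≤ f p) {τ : ℝ} {x y : P}
    (hx : f x - topPart f τ x ≠ 0) (hy : topPart f τ y ≠ 0) : ¬ y < x := by
  intro hxy
  have h := add_massAbove_le_massAbove hf hxy
  have hy' : massAbove f y < τ := by
    by_contra hn
    exact hy (max_eq_left (min_le_of_right_le (by linarith)))
  refine hx ?_
  rw [topPart, min_eq_left (by linarith), max_eq_right (hf x), sub_self]

theorem prism_zero (θ : P → P) {f : P → ℝ} (hf : ∀ p, 0 ≤ f p) : prism θ f 0 = f := by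
  funext y
  simp [prism, topPart_zero hf]

theorem exists_of_prism_ne_zero {θ : P → P} {f : P → ℝ} {τ : ℝ} {y : P} (hy : prism θ f τ y ≠ 0) :
    f y - topPart f τ y ≠ 0 ∨ ∃ x, θ x = y ∧ topPart f τ x ≠ 0 := by
  by_contra! h
  refine hy ?_
  rw [prism, h.1, zero_add]
  exact Finset.sum_eq_zero fun x _ => by
    split_ifs with hx
    · exact h.2 x hx
    · rfl

theorem exists_of_prism_one_ne_zero {θ : P → P} {f : P → ℝ} (hf : f ∈ orderComplex P) {y : P}
    (hy : prism θ f 1 y ≠ 0) : ∃ x, f x ≠ 0 ∧ θ x = y := by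
  rcases exists_of_prism_ne_zero hy with h | ⟨x, hx, h⟩
  · simp [topPart_one hf] at h
  · exact ⟨x, topPart_one hf x ▸ h, hx⟩

open Classical in
/-- Moving mass along `θ` preserves the mass of every set invariant under `θ` both ways. -/
theorem sum_prism (U : Set P) {θ : P → P} (hθ : ∀ x, θ x ∈ U ↔ x ∈ U) (f : P → ℝ) (τ : ℝ) :
    ∑ y, (if y ∈ U then prism θ f τ y else 0) = ∑ y, if y ∈ U then f y else 0 := by
  have h : ∑ y, (if y ∈ U then ∑ x, (if θ x = y then topPart f τ x else 0) else 0)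
      = ∑ x, if x ∈ U then topPart f τ x else 0 := by
    have h1 : ∀ y, (if y ∈ U then ∑ x, (if θ x = y then topPart f τ x else 0) else 0)
        = ∑ x, if θ x = y then (if x ∈ U then topPart f τ x else 0) else 0 := by
      intro y
      split_ifs with hy
      · refine Finset.sum_congr rfl fun x _ => ?_
        split_ifs with h1 h2
        · rfl
        · exact absurd ((hθ x).1 (h1 ▸ hy)) h2
        · rfl
      · refine (Finset.sum_eq_zero fun x _ => ?_).symm
        split_ifs with h1 h2
        · exact absurd (h1 ▸ (hθ x).2 h2) hy
        · rfl
        · rfl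
    rw [Finset.sum_congr rfl fun y _ => h1 y, Finset.sum_comm]
    simp
  have h2 : ∀ y, (if y ∈ U then prism θ f τ y else 0)
      = ((if y ∈ U then f y else 0) - (if y ∈ U then topPart f τ y else 0))
        + (if y ∈ U then ∑ x, (if θ x = y then topPart f τ x else 0) else 0) := by
    intro y
    split_ifs <;> simp [prism]
  rw [Finset.sum_congr rfl fun y _ => h2 y, Finset.sum_add_distrib, Finset.sum_sub_distrib, h]
  ring

theorem prism_mem {θ : P → P} {f : P → ℝ} (hf : f ∈ orderComplex P) {τ : ℝ}
    (hle : τ ≠ 0 → ∀ x, f x ≠ 0 → x ≤ θ x) (hmono : τ ≠ 0 → MonotoneOn θ {x | f x ≠ 0}) :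
    prism θ f τ ∈ orderComplex P := by
  classical
  obtain ⟨h0, h1, hc⟩ := mem_orderComplex_iff.1 hf
  by_cases hτ : τ = 0
  · rwa [hτ, prism_zero θ h0]
  have hle := hle hτ
  have hmono := hmono hτ
  refine mem_orderComplex_iff.2 ⟨fun y => ?_, ?_, ?_⟩
  · refine add_nonneg (sub_nonneg.2 (topPart_le h0 τ y)) (Finset.sum_nonneg fun x _ => ?_)
    split_ifs
    · exact topPart_nonneg f τ x
    · exact le_rfl
  · have := sum_prism Set.univ (θ := θ) (by simp) f τ
    simpa [h1] using this
  · have key : ∀ x y, f x - topPart f τ x ≠ 0 → topPart f τ y ≠ 0 → x ≤ θ y := by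
      intro x y hx hy
      have hfx : f x ≠ 0 := fun h => hx (by simp [h, topPart_eq_zero h0 h])
      have hfy : f y ≠ 0 := fun h => hy (topPart_eq_zero h0 h)
      have hxy : x ≤ y := by
        rcases hc.total hfx hfy with h | h
        · exact h
        · rcases h.lt_or_eq with h | h
          · exact absurd h (not_lt_of_topPart h0 hx hy)
          · exact h.ge
      exact hxy.trans (hle y hfy)
    intro x hx y hy _
    obtain hx' | ⟨x, rfl, hx'⟩ := exists_of_prism_ne_zero hx <;>
      obtain hy' | ⟨y, rfl, hy'⟩ := exists_of_prism_ne_zero hy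
    · refine hc.total (fun h => hx' ?_) (fun h => hy' ?_) <;> simp [h, topPart_eq_zero h0 h]
    · exact Or.inl (key x _ hx' hy')
    · exact Or.inr (key y _ hy' hx')
    · have hfx : f x ≠ 0 := fun h => hx' (topPart_eq_zero h0 h)
      have hfy : f y ≠ 0 := fun h => hy' (topPart_eq_zero h0 h)
      exact (hc.total hfx hfy).imp (hmono hfx hfy) (hmono hfy hfx)

theorem continuous_prism (θ : P → P) {Z : Type*} [TopologicalSpace Z] {f : Z → P → ℝ} {τ : Z → ℝ}
    (hf : Continuous f) (hτ : Continuous τ) : Continuous fun z => prism θ (f z) (τ z) := by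
  have hfp : ∀ p, Continuous fun z => f z p := fun p => (continuous_apply p).comp hf
  have hm : ∀ x, Continuous fun z => massAbove (f z) x := fun x =>
    continuous_finsetSum _ fun y _ => by split_ifs <;> fun_prop
  have ht : ∀ x, Continuous fun z => topPart (f z) (τ z) x := fun x =>
    continuous_const.max ((hfp x).min (hτ.sub (hm x)))
  refine continuous_pi fun y => ((hfp y).sub (ht y)).add (continuous_finsetSum _ fun x _ => ?_)
  split_ifs <;> fun_prop

/-- A map into an order complex is homotopic to the one obtained by moving the top part of the
mass upwards along a map which is increasing where this mass lives. -/
theorem exists_homotopic_prism (θ : P → P) {Y : Type*} [TopologicalSpace Y]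
    (F : C(Y, orderComplex P)) (τ : C(Y, ℝ))
    (hle : ∀ y, τ y ≠ 0 → ∀ x, (F y).1 x ≠ 0 → x ≤ θ x)
    (hmono : ∀ y, τ y ≠ 0 → MonotoneOn θ {x | (F y).1 x ≠ 0}) :
    ∃ G : C(Y, orderComplex P), (∀ y, (G y).1 = prism θ (F y).1 (τ y)) ∧ F.Homotopic G := by
  refine ⟨⟨fun y => ⟨prism θ (F y).1 (τ y), prism_mem (F y).2 (hle y) (hmono y)⟩, ?_⟩,
    fun y => rfl, ⟨⟨⟨fun z => ⟨prism θ (F z.2).1 (z.1 * τ z.2), ?_⟩, ?_⟩, ?_, ?_⟩⟩⟩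
  · exact Continuous.subtype_mk
      (continuous_prism θ (continuous_subtype_val.comp F.continuous) τ.continuous) _
  · exact prism_mem (F z.2).2 (fun h => hle z.2 (right_ne_zero_of_mul h))
      (fun h => hmono z.2 (right_ne_zero_of_mul h))
  · refine Continuous.subtype_mk (continuous_prism θ
      (continuous_subtype_val.comp (F.continuous.comp continuous_snd)) ?_) _
    fun_prop
  · intro y
    ext p
    simp [prism_zero θ (mem_orderComplex_iff.1 (F y).2).1]
  · intro y
    ext p
    simp

open Classical in
/-- Discard the mass of `f` in `U`, put some mass at `q` if less than half of the mass remains,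
and rescale. -/
noncomputable def dropMass (U : Set P) (q : P) (f : P → ℝ) (p : P) : ℝ :=
  ((if p ∈ U then 0 else f p)
      + if p = q then max 0 (2 * (∑ x, if x ∈ U then f x else 0) - 1) else 0)
    / (1 - (∑ x, if x ∈ U then f x else 0) + max 0 (2 * (∑ x, if x ∈ U then f x else 0) - 1))

theorem dropMass_denom_pos (t : ℝ) : 0 < 1 - t + max 0 (2 * t - 1) := by
  rcases le_total t (1 / 2) with h | h
  · linarith [le_max_left 0 (2 * t - 1)]
  · linarith [le_max_right 0 (2 * t - 1)]

open Classical in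
theorem dropMass_ne_zero {Q : Type*} [Fintype Q] {U : Set Q} {q : Q} {f : Q → ℝ} {p : Q}
    (hp : dropMass U q f p ≠ 0) :
    (p ∉ U ∧ f p ≠ 0) ∨ (p = q ∧ 1 / 2 < ∑ x, if x ∈ U then f x else 0) := by
  by_contra! h
  refine hp ?_
  have h1 : (if p ∈ U then 0 else f p) = 0 := by
    split_ifs with hU
    · rfl
    · exact h.1 hU
  have h2 : (if p = q then max 0 (2 * (∑ x, if x ∈ U then f x else 0) - 1) else 0) = 0 := by
    split_ifs with hq
    · exact max_eq_left (by linarith [h.2 hq])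
    · rfl
  rw [dropMass, h1, h2]
  simp

open Classical in
theorem isChain_dropMass_union {U : Set P} {q : P} {f : P → ℝ} (hf : f ∈ orderComplex P)
    (hq : 1 / 2 < (∑ x, if x ∈ U then f x else 0) → ∀ x, f x ≠ 0 → q ≤ x) :
    IsChain (· ≤ ·) ({p | f p ≠ 0} ∪ {p | dropMass U q f p ≠ 0}) := by
  have hc := (mem_orderComplex_iff.1 hf).2.2
  by_cases ht : 1 / 2 < (∑ x, if x ∈ U then f x else 0)
  · refine (hc.insert fun x hx _ => Or.inl (hq ht x hx)).mono ?_
    rintro p (hp | hp)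
    · exact Or.inr hp
    · exact (dropMass_ne_zero hp).elim (fun h => Or.inr h.2) (fun h => Or.inl h.1)
  · refine hc.mono ?_
    rintro p (hp | hp)
    · exact hp
    · exact (dropMass_ne_zero hp).elim (fun h => h.2) (fun h => absurd h.2 ht)

open Classical in
theorem dropMass_mem {U : Set P} {q : P} {f : P → ℝ} (hf : f ∈ orderComplex P)
    (hq : 1 / 2 < (∑ x, if x ∈ U then f x else 0) → ∀ x, f x ≠ 0 → q ≤ x) :
    dropMass U q f ∈ orderComplex P := by
  obtain ⟨h0, h1, -⟩ := mem_orderComplex_iff.1 hf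
  refine mem_orderComplex_iff.2 ⟨fun p => ?_, ?_,
    (isChain_dropMass_union hf hq).mono Set.subset_union_right⟩
  · refine div_nonneg (add_nonneg ?_ ?_) (dropMass_denom_pos _).le
    · split_ifs
      · exact le_rfl
      · exact h0 p
    · split_ifs
      · exact le_max_left _ _
      · exact le_rfl
  · have h2 : ∑ p, (if p ∈ U then 0 else f p) = 1 - ∑ x, if x ∈ U then f x else 0 := by
      rw [← h1, ← Finset.sum_sub_distrib]
      exact Finset.sum_congr rfl fun x _ => by split_ifs <;> simp
    simp only [dropMass]
    rw [← Finset.sum_div, Finset.sum_add_distrib, h2]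
    simp only [Finset.sum_ite_eq', Finset.mem_univ, if_true]
    exact div_self (dropMass_denom_pos _).ne'

theorem continuous_dropMass {Q : Type*} [Fintype Q] (U : Set Q) (q : Q) :
    Continuous (dropMass U q) := by
  classical
  have ht : Continuous fun f : Q → ℝ => ∑ x, if x ∈ U then f x else 0 :=
    continuous_finsetSum _ fun x _ => by split_ifs <;> fun_prop
  refine continuous_pi fun p => Continuous.div (Continuous.add ?_ ?_) (by fun_prop)
    fun f => (dropMass_denom_pos _).ne'
  · split_ifs <;> fun_prop
  · split_ifs <;> fun_prop

/-- A finite poset has contractible order complex if, for some upper set `U`, the complement of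
`U` is conically contractible to `s` via `ψ`, and the elements lying below some element of `U`
are conically contractible to `q` via `φ`, compatibly with `U`. -/
theorem contractibleSpace_orderComplex_s11 (U : Set P) (hU : IsUpperSet U) (φ ψ : P → P) (q s : P)
    (hφU : ∀ x, φ x ∈ U ↔ x ∈ U) (hφ : ∀ x, x ≤ φ x)
    (hφmono : MonotoneOn φ {x | ∃ v ∈ U, x ≤ v}) (hq : q ∉ U)
    (hqφ : ∀ x, (∃ v ∈ U, x ≤ v) → q ≤ φ x)
    (hψ : ∀ x ∉ U, x ≤ ψ x) (hψmono : MonotoneOn ψ Uᶜ) (hsψ : ∀ x ∉ U, s ≤ ψ x) :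
    ContractibleSpace (orderComplex P) := by
  classical
  rw [contractible_iff_id_nullhomotopic]
  have hsub : ∀ f ∈ orderComplex P, (∑ x, if x ∈ U then f x else 0) ≠ 0 →
      ∀ x, f x ≠ 0 → ∃ v ∈ U, x ≤ v := by
    intro f hf ht x hx
    obtain ⟨v, -, hv⟩ := Finset.exists_ne_zero_of_sum_ne_zero ht
    by_cases hvU : v ∈ U
    · rw [if_pos hvU] at hv
      rcases (mem_orderComplex_iff.1 hf).2.2.total hx hv with h | h
      · exact ⟨v, hvU, h⟩
      · exact ⟨x, hU h hvU, le_rfl⟩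
    · exact absurd (if_neg hvU) hv
  let τ : C(orderComplex P, ℝ) :=
    ⟨fun f => min 1 (2 * ∑ x, if x ∈ U then f.1 x else 0), by
      refine continuous_const.min (continuous_const.mul (continuous_finsetSum _ fun x _ => ?_))
      split_ifs
      · exact (continuous_apply x).comp continuous_subtype_val
      · exact continuous_const⟩
  have hτ : ∀ f : orderComplex P, τ f ≠ 0 → (∑ x, if x ∈ U then f.1 x else 0) ≠ 0 := by
    intro f h h'
    refine h ?_
    change min 1 (2 * ∑ x, if x ∈ U then f.1 x else 0) = 0
    rw [h']
    simp
  obtain ⟨F₁, hF₁, h01⟩ := exists_homotopic_prism φ (ContinuousMap.id (orderComplex P)) τ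
    (fun f _ x _ => hφ x)
    (fun f h => hφmono.mono fun x hx => hsub f.1 f.2 (hτ f h) x hx)
  have hqF : ∀ f : orderComplex P, 1 / 2 < (∑ x, if x ∈ U then (F₁ f).1 x else 0) →
      ∀ x, (F₁ f).1 x ≠ 0 → q ≤ x := by
    intro f ht x hx
    rw [hF₁] at ht hx
    rw [sum_prism U hφU] at ht
    simp only [ContinuousMap.id_apply] at ht hx
    have h1 : τ f = 1 := min_eq_left (by linarith)
    rw [h1] at hx
    obtain ⟨y, hy, rfl⟩ := exists_of_prism_one_ne_zero f.2 hx
    exact hqφ y (hsub f.1 f.2 (by linarith) y hy)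
  let F₂ : C(orderComplex P, orderComplex P) :=
    ⟨fun f => ⟨dropMass U q (F₁ f).1, dropMass_mem (F₁ f).2 (hqF f)⟩,
      Continuous.subtype_mk
        ((continuous_dropMass U q).comp (continuous_subtype_val.comp F₁.continuous)) _⟩
  have h12 : F₁.Homotopic F₂ :=
    homotopic_of_isChain_union _ _ fun f => isChain_dropMass_union (F₁ f).2 (hqF f)
  have hF₂ : ∀ f x, (F₂ f).1 x ≠ 0 → x ∉ U := by
    intro f x hx
    rcases dropMass_ne_zero hx with h | h
    · exact h.1
    · exact h.1 ▸ hq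
  obtain ⟨F₃, hF₃, h23⟩ := exists_homotopic_prism ψ F₂ (ContinuousMap.const _ 1)
    (fun f _ x hx => hψ x (hF₂ f x hx)) (fun f _ => hψmono.mono fun x hx => hF₂ f x hx)
  have hs : (fun p => if p = s then (1 : ℝ) else 0) ∈ orderComplex P := by
    refine mem_orderComplex_iff.2 ⟨fun p => by positivity, by simp, ?_⟩
    refine (IsChain.singleton (a := s)).mono fun p hp => ?_
    by_contra h
    exact hp (if_neg h)
  refine ⟨⟨_, hs⟩, h01.trans (h12.trans (h23.trans (homotopic_of_isChain_union _ _ fun f => ?_)))⟩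
  have hc := (mem_orderComplex_iff.1 (F₃ f).2).2.2
  refine (hc.insert (a := s) fun x hx _ => Or.inl ?_).mono ?_
  · rw [Set.mem_ofPred_eq, hF₃] at hx
    obtain ⟨y, hy, rfl⟩ := exists_of_prism_one_ne_zero (F₂ f).2 hx
    exact hsψ y (hF₂ f y hy)
  · rintro p (hp | hp)
    · exact Or.inr hp
    · by_contra h
      exact hp (if_neg fun h' => h (Or.inl h'))

end OrderComplex

/-- The relation generated by the order `T` and the pair `(p, q)`. -/
def adjoin (T : Set (X × X)) (p q : X) : Set (X × X) :=
  T ∪ {z | (z.1, p) ∈ T ∧ (q, z.2) ∈ T}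

theorem adjoin_mono {T T' : Set (X × X)} (h : T ⊆ T') (p q : X) : adjoin T p q ⊆ adjoin T' p q :=
  Set.union_subset_union h fun _ hz => ⟨h hz.1, h hz.2⟩

theorem mem_adjoin {T : Set (X × X)} (hT : IsOrder T) (p q : X) : (p, q) ∈ adjoin T p q :=
  Or.inr ⟨hT.1 p, hT.1 q⟩

theorem adjoin_eq_self {T : Set (X × X)} (hT : IsOrder T) {p q : X} (h : (p, q) ∈ T) :
    adjoin T p q = T :=
  Set.union_eq_left.2 fun z hz => hT.2.1 z.1 q z.2 (hT.2.1 z.1 p q hz.1 h) hz.2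

theorem isOrder_adjoin {T : Set (X × X)} (hT : IsOrder T) {p q : X} (h : (q, p) ∉ T) :
    IsOrder (adjoin T p q) := by
  obtain ⟨hr, ht, ha⟩ := hT
  refine ⟨fun x => Or.inl (hr x), ?_, ?_⟩
  · rintro x y z (h1 | ⟨h1, h2⟩) (h3 | ⟨h3, h4⟩)
    · exact Or.inl (ht _ _ _ h1 h3)
    · exact Or.inr ⟨ht _ _ _ h1 h3, h4⟩
    · exact Or.inr ⟨h1, ht _ _ _ h2 h3⟩
    · exact Or.inr ⟨h1, h4⟩
  · rintro x y (h1 | ⟨h1, h2⟩) (h3 | ⟨h3, h4⟩)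
    · exact ha _ _ h1 h3
    · exact absurd (ht _ _ _ h4 (ht _ _ _ h1 h3)) h
    · exact absurd (ht _ _ _ h2 (ht _ _ _ h3 h1)) h
    · exact absurd (ht _ _ _ h2 h3) h

/-- If `p` and `q` are incomparable, they are adjacent once `(p, q)` has been adjoined, so this
pair can be removed again. -/
theorem isOrder_adjoin_diff {T : Set (X × X)} (hT : IsOrder T) {p q : X} (h : (p, q) ∉ T)
    (h' : (q, p) ∉ T) : IsOrder (adjoin T p q \ {(p, q)}) := by
  obtain ⟨hr, ht, ha⟩ := isOrder_adjoin hT h'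
  have hne : p ≠ q := fun e => h (e ▸ hT.1 p)
  refine ⟨fun x => ⟨hr x, fun e => ?_⟩, fun x y z hxy hyz => ⟨ht _ _ _ hxy.1 hyz.1, fun e => ?_⟩,
    fun x y hxy hyx => ha _ _ hxy.1 hyx.1⟩
  · obtain ⟨e₁, e₂⟩ := Prod.mk.inj e
    exact hne (e₁.symm.trans e₂)
  · obtain ⟨rfl, rfl⟩ := Prod.mk.inj e
    obtain ⟨h1, n1⟩ := hxy
    obtain ⟨h2, n2⟩ := hyz
    rcases h1 with h1 | ⟨-, h1⟩ <;> rcases h2 with h2 | ⟨h2, -⟩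
    · exact h (hT.2.1 _ _ _ h1 h2)
    · exact n2 (by rw [hT.2.2 _ _ h1 h2]; rfl)
    · exact n1 (by rw [hT.2.2 _ _ h1 h2]; rfl)
    · exact h' (hT.2.1 _ _ _ h1 h2)

theorem ssubset_adjoin_diff {R : Set (X × X)} {p q : X} (hR : IsOrder R)
    (h : (p, q) ∉ R) (hqp : (q, p) ∉ R) (hE : (p, q) ∉ eSet R) : R ⊂ adjoin R p q \ {(p, q)} := by
  refine ⟨fun z hz => ⟨Or.inl hz, fun e => h (e ▸ hz)⟩, fun hsub => hE ?_⟩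
  refine ⟨fun hn => hn.elim h hqp, fun z hz => ?_, fun z hz => ?_⟩
  · refine ⟨hsub ⟨Or.inr ⟨hz.1, hR.1 q⟩, fun e => hz.2 (Prod.mk.inj e).1⟩, ?_⟩
    rintro rfl
    exact hqp hz.1
  · refine ⟨hsub ⟨Or.inr ⟨hR.1 p, hz.1⟩, fun e => hz.2 (Prod.mk.inj e).2.symm⟩, ?_⟩
    rintro rfl
    exact hqp hz.1

/-- Theorem 5.3(1): if there is `(a, b) ∈ 𝓔_R` with `(b, a) ∉ 𝓔_R`, then the poset
`]R, ·[` of orders strictly containing `R` is contractible. -/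
theorem upperInterval_contractible {X : Type*} [Fintype X]
    (R : Set (X × X)) (hR : IsOrder R)
    (a b : X) (hab : (a, b) ∈ eSet R) (hba : (b, a) ∉ eSet R) :
    ContractibleSpace (orderComplex {T : Set (X × X) // IsOrder T ∧ R ⊂ T}) := by
  classical
  have habR : (a, b) ∉ R := fun h => hab.1 (Or.inl h)
  have hbaR : (b, a) ∉ R := fun h => hab.1 (Or.inr h)
  have hne : a ≠ b := fun e => habR (e ▸ hR.1 a)
  let P := {T : Set (X × X) // IsOrder T ∧ R ⊂ T}
  let _ : Fintype P := Fintype.ofFinite P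
  let φ : P → P := fun T =>
    if h : (b, a) ∉ T.1 ∧ (a, b) ∉ T.1 then
      ⟨adjoin T.1 b a \ {(b, a)}, isOrder_adjoin_diff T.2.1 h.1 h.2,
        T.2.2.trans_subset fun z hz => ⟨Or.inl hz, fun e => h.1 (e ▸ hz)⟩⟩
    else T
  let ψ : P → P := fun T =>
    if h : (b, a) ∉ T.1 then
      ⟨adjoin T.1 a b, isOrder_adjoin T.2.1 h, T.2.2.trans_subset Set.subset_union_left⟩
    else T
  have hφ_eq : ∀ T : P, (b, a) ∉ T.1 → (a, b) ∉ T.1 → (φ T).1 = adjoin T.1 b a \ {(b, a)} :=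
    fun T h h' => congrArg Subtype.val (dif_pos ⟨h, h'⟩)
  have hφ_self : ∀ T : P, ¬ ((b, a) ∉ T.1 ∧ (a, b) ∉ T.1) → φ T = T := fun T h => dif_neg h
  have hψ_eq : ∀ T : P, (b, a) ∉ T.1 → (ψ T).1 = adjoin T.1 a b :=
    fun T h => congrArg Subtype.val (dif_pos h)
  have hlow : ∀ T : P, (∃ V ∈ {V : P | (b, a) ∈ V.1}, T ≤ V) → (a, b) ∉ T.1 := by
    rintro T ⟨V, hV, hTV⟩ h
    exact hne (V.2.1.2.2 _ _ (hTV h) hV)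
  refine contractibleSpace_orderComplex_s11 (P := P) {T | (b, a) ∈ T.1} (fun T V h hT => h hT) φ ψ
    ⟨adjoin R b a \ {(b, a)}, isOrder_adjoin_diff hR hbaR habR,
      ssubset_adjoin_diff hR hbaR habR hba⟩
    ⟨adjoin R a b, isOrder_adjoin hR hbaR, Set.subset_union_left,
      fun h => habR (h (mem_adjoin hR a b))⟩
    ?_ ?_ ?_ ?_ ?_ ?_ ?_ ?_
  · intro T
    by_cases h : (b, a) ∉ T.1 ∧ (a, b) ∉ T.1
    · simp [hφ_eq T h.1 h.2, h.1]
    · rw [hφ_self T h]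
  · intro T
    by_cases h : (b, a) ∉ T.1 ∧ (a, b) ∉ T.1
    · intro z hz
      rw [hφ_eq T h.1 h.2]
      exact ⟨Or.inl hz, fun e => h.1 (e ▸ hz)⟩
    · rw [hφ_self T h]
  · intro T hT V hV hTV
    change (φ T).1 ⊆ (φ V).1
    by_cases hbV : (b, a) ∈ V.1
    · rw [hφ_self V fun h => h.1 hbV]
      by_cases hbT : (b, a) ∈ T.1
      · rwa [hφ_self T fun h => h.1 hbT]
      · rw [hφ_eq T hbT (hlow T hT)]
        exact Set.sdiff_subset.trans ((adjoin_mono hTV b a).trans (adjoin_eq_self V.2.1 hbV).le)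
    · rw [hφ_eq V hbV (hlow V hV), hφ_eq T (fun h => hbV (hTV h)) (hlow T hT)]
      exact Set.sdiff_subset_sdiff_left (adjoin_mono hTV b a)
  · exact fun h => h.2 rfl
  · intro T hT
    change _ ⊆ (φ T).1
    by_cases hbT : (b, a) ∈ T.1
    · rw [hφ_self T fun h => h.1 hbT]
      exact Set.sdiff_subset.trans ((adjoin_mono T.2.2.1 b a).trans (adjoin_eq_self T.2.1 hbT).le)
    · rw [hφ_eq T hbT (hlow T hT)]
      exact Set.sdiff_subset_sdiff_left (adjoin_mono T.2.2.1 b a)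
  · intro T hT
    change _ ⊆ (ψ T).1
    rw [hψ_eq T hT]
    exact Set.subset_union_left
  · intro T hT V hV hTV
    change (ψ T).1 ⊆ (ψ V).1
    rw [hψ_eq T hT, hψ_eq V hV]
    exact adjoin_mono hTV a b
  · intro T hT
    change _ ⊆ (ψ T).1
    rw [hψ_eq T hT]
    exact adjoin_mono T.2.2.1 a b
end
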